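/- For any a and distinct b,c in {1,…,ℓ}, the following hold in A(𝓗^+): ω_a * E^u_{bc} = δ_{ab} E^u_{bc}, E^u_{bc} * ω_a = δ_{ac} E^u_{bc}, ω_a * E^t_{bc} = (1/16 + δ_{ab}/2) E^t_{bc}, and E^t_{bc} * ω_a = (1/16 + δ_{ac}/2) E^t_{bc}. -/

import Mathlib

/-!
Common framework: vertex operator algebras over ℂ encoded via their modes,
weak/admissible/ordinary modules, twisted modules, Zhu's algebra data,
and the free bosonic (Heisenberg) vertex operator algebra `𝓗 = M(1)` of rank `ℓ`
together with its `θ`-fixed subalgebra `𝓗⁺`.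
-/

open scoped BigOperators DirectSum TensorProduct

noncomputable section

/-- Generalized binomial coefficient `(q choose n)` for `q : ℚ`. -/
def qchoose (q : ℚ) : ℕ → ℚ
  | 0 => 1
  | n + 1 => qchoose q n * (q - n) / (n + 1)

/-- Generalized binomial coefficient of an integer, as a complex number. -/
def zchoose (m : ℤ) (n : ℕ) : ℂ := ((qchoose (m : ℚ) n : ℚ) : ℂ)

/-- A vertex operator algebra over `ℂ`, encoded through its modes:
`Y u n : Module.End ℂ V` is the `n`-th mode `u_n` of the vertex operator `Y(u,z)`.
The axioms are: truncation, the vacuum and creation axioms, the (component form of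
the) Jacobi/Borcherds identity, a lower-truncated `ℤ`-grading by `L(0)`-eigenvalues
with finite dimensional homogeneous pieces compatible with the modes, the Virasoro
relations for the conformal vector and the `L(-1)`-derivative (translation) axiom. -/
structure VOA (V : Type) [AddCommGroup V] [Module ℂ V] : Type where
  Y : V →ₗ[ℂ] ℤ → Module.End ℂ V
  one : V
  omega : V
  wt : ℤ → Submodule ℂ V
  centralCharge : ℂ
  internal : DirectSum.IsInternal wt
  one_wt : one ∈ wt 0
  omega_wt : omega ∈ wt 2
  one_ne_zero : one ≠ 0
  fdim : ∀ n : ℤ, FiniteDimensional ℂ (wt n)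
  bounded_below : ∃ N : ℤ, ∀ n : ℤ, n < N → wt n = ⊥
  trunc : ∀ u v : V, ∃ N : ℤ, ∀ n : ℤ, N ≤ n → Y u n v = 0
  vacuum_act : ∀ n : ℤ, Y one n = if n = -1 then (1 : Module.End ℂ V) else 0
  create : ∀ u : V, Y u (-1) one = u
  create_ge : ∀ (u : V) (n : ℤ), 0 ≤ n → Y u n one = 0
  mode_wt : ∀ (k : ℤ) (u : V), u ∈ wt k → ∀ (m n : ℤ) (v : V), v ∈ wt m →
    Y u n v ∈ wt (m + k - n - 1)
  L0_diag : ∀ (n : ℤ) (v : V), v ∈ wt n → Y omega 1 v = (n : ℂ) • v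
  translation : ∀ (u : V) (n : ℤ), Y (Y omega 0 u) n = (-(n : ℂ)) • Y u (n - 1)
  virasoro : ∀ m n : ℤ,
    Y omega (m + 1) * Y omega (n + 1) - Y omega (n + 1) * Y omega (m + 1)
      = ((m : ℂ) - (n : ℂ)) • Y omega (m + n + 1)
        + (if m + n = 0 then (((m ^ 3 - m : ℤ) : ℂ) / 12) * centralCharge else 0)
            • (1 : Module.End ℂ V)
  borcherds : ∀ (u v w : V) (p m n : ℤ),
    ∑ᶠ i : ℕ, zchoose m i • Y (Y u (p + i) v) (m + n - i) w
      = ∑ᶠ i : ℕ, ((-1 : ℂ) ^ i * zchoose p i) •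
          (Y u (m + p - i) (Y v (n + i) w)
            - ((-1 : ℂ) ^ p) • Y v (n + p - i) (Y u (m + i) w))

variable {V : Type} [AddCommGroup V] [Module ℂ V]

/-- Simplicity of a vertex operator algebra: the only subspaces invariant under
all modes are `0` and the whole space. -/
def VOA.Simple (A : VOA V) : Prop :=
  ∀ U : Submodule ℂ V, (∀ (u : V) (n : ℤ) (v : V), v ∈ U → A.Y u n v ∈ U) → U = ⊥ ∨ U = ⊤

/-- The decomposition of a vertex operator algebra into its homogeneous pieces. -/
noncomputable def VOA.decompose (A : VOA V) : V ≃ₗ[ℂ] ⨁ n : ℤ, A.wt n :=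
  (LinearEquiv.ofBijective (DirectSum.coeLinearMap A.wt) A.internal).symm

/-- The homogeneous component of weight `n` of a vector. -/
noncomputable def VOA.hcomp (A : VOA V) (n : ℤ) (u : V) : V := (A.decompose u n : V)

/-- Zhu's product `u * v` for `u` (treated as) homogeneous of weight `k`:
`u*v = ∑_{i≥0} (k choose i) u_{i-1} v`. -/
noncomputable def VOA.mulAux (A : VOA V) (k : ℤ) (u v : V) : V :=
  ∑ᶠ i : ℕ, zchoose k i • A.Y u ((i : ℤ) - 1) v

/-- Zhu's circle product `u ∘ v` for `u` (treated as) homogeneous of weight `k`: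
`u∘v = ∑_{i≥0} (k choose i) u_{i-2} v`. -/
noncomputable def VOA.circAux (A : VOA V) (k : ℤ) (u v : V) : V :=
  ∑ᶠ i : ℕ, zchoose k i • A.Y u ((i : ℤ) - 2) v

/-- Zhu's product `u * v`, extended bilinearly via homogeneous components of `u`. -/
noncomputable def VOA.star (A : VOA V) (u v : V) : V :=
  ∑ᶠ k : ℤ, A.mulAux k (A.hcomp k u) v

/-- The subspace `O(V)` spanned by all circle products `u ∘ v` with `u` homogeneous;
Zhu's algebra is `A(V) = V/O(V)` with product induced by `VOA.star`. -/
def VOA.Osub (A : VOA V) : Submodule ℂ V :=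
  Submodule.span ℂ {w | ∃ (k : ℤ) (u v : V), u ∈ A.wt k ∧ w = A.circAux k u v}

/-- A weak module for a vertex operator algebra, given by modes satisfying
truncation, the vacuum axiom and the Borcherds identity. -/
structure WkMod (A : VOA V) (M : Type) [AddCommGroup M] [Module ℂ M] : Type where
  act : V →ₗ[ℂ] ℤ → Module.End ℂ M
  trunc : ∀ (u : V) (w : M), ∃ N : ℤ, ∀ n : ℤ, N ≤ n → act u n w = 0
  vacuum_act : ∀ n : ℤ, act A.one n = if n = -1 then (1 : Module.End ℂ M) else 0
  borcherds : ∀ (u v : V) (w : M) (p m n : ℤ),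
    ∑ᶠ i : ℕ, zchoose m i • act (A.Y u (p + i) v) (m + n - i) w
      = ∑ᶠ i : ℕ, ((-1 : ℂ) ^ i * zchoose p i) •
          (act u (m + p - i) (act v (n + i) w)
            - ((-1 : ℂ) ^ p) • act v (n + p - i) (act u (m + i) w))

/-- An admissible (`ℕ`-gradable) module for a vertex operator algebra:
a weak module with an `ℕ`-grading with nonzero top level, compatible with weights. -/
structure AdmMod (A : VOA V) (M : Type) [AddCommGroup M] [Module ℂ M]
    extends WkMod A M : Type where
  gr : ℕ → Submodule ℂ M
  grInternal : DirectSum.IsInternal gr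
  top_ne_bot : gr 0 ≠ ⊥
  gr_mode : ∀ (k : ℤ) (u : V), u ∈ A.wt k → ∀ (m : ℤ) (n : ℕ) (w : M), w ∈ gr n →
    act u m w ∈
      if 0 ≤ (n : ℤ) + k - m - 1 then gr ((n : ℤ) + k - m - 1).toNat else ⊥

/-- An ordinary module for a vertex operator algebra: a weak module on which `L(0)`
acts semisimply with finite dimensional eigenspaces whose weights are truncated from
below in each coset `λ + ℤ`. -/
structure OrdMod (A : VOA V) (M : Type) [AddCommGroup M] [Module ℂ M]
    extends WkMod A M : Type where
  wtm : ℂ → Submodule ℂ M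
  indep : iSupIndep wtm
  spans : ⨆ c : ℂ, wtm c = ⊤
  L0_diag : ∀ (c : ℂ) (w : M), w ∈ wtm c → act A.omega 1 w = c • w
  fdim : ∀ c : ℂ, FiniteDimensional ℂ (wtm c)
  bounded_below : ∀ c : ℂ, ∃ N : ℤ, ∀ m : ℤ, m < N → wtm (c + m) = ⊥

/-- Irreducibility of a weak module. -/
def WkMod.Irreducible {A : VOA V} {M : Type} [AddCommGroup M] [Module ℂ M]
    (P : WkMod A M) : Prop :=
  (∃ w : M, w ≠ 0) ∧
    ∀ U : Submodule ℂ M, (∀ (u : V) (n : ℤ) (w : M), w ∈ U → P.act u n w ∈ U) →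
      U = ⊥ ∨ U = ⊤

/-- Isomorphism of two weak modules over the same vertex operator algebra. -/
def ModIso (A : VOA V) {M N : Type} [AddCommGroup M] [Module ℂ M]
    [AddCommGroup N] [Module ℂ N] (P : WkMod A M) (Q : WkMod A N) : Prop :=
  ∃ f : M ≃ₗ[ℂ] N, ∀ (u : V) (n : ℤ) (w : M), f (P.act u n w) = Q.act u n (f w)

/-- The action of the zero-mode `o(u) = u_{wt u - 1}` (extended linearly from
homogeneous vectors) on a weak module; it preserves the top level of an
admissible module. -/
noncomputable def WkMod.oAct {A : VOA V} {M : Type} [AddCommGroup M] [Module ℂ M]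
    (Q : WkMod A M) (u : V) (w : M) : M :=
  ∑ᶠ k : ℤ, Q.act (A.hcomp k u) (k - 1) w

/-- Action of a word of creation operators `h_{a_1}(-n_1) ⋯ h_{a_k}(-n_k)`. -/
def wordAct {ℓ : ℕ} {M : Type} (f : Fin ℓ → ℤ → M → M) : List (Fin ℓ × ℕ+) → M → M
  | [], w => w
  | (a, n) :: L, w => f a (-((n : ℕ) : ℤ)) (wordAct f L w)

/-- Action of a word of twisted creation operators
`h_{a_1}(-n_1+1/2) ⋯ h_{a_k}(-n_k+1/2)` (indices doubled). -/
def twWordAct {ℓ : ℕ} {M : Type} (f : Fin ℓ → ℤ → M → M) : List (Fin ℓ × ℕ+) → M → M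
  | [], w => w
  | (a, n) :: L, w => f a (-(2 * ((n : ℕ) : ℤ) - 1)) (twWordAct f L w)

/-- `A` is the rank `ℓ` free bosonic (Heisenberg) vertex operator algebra
`𝓗 = M(1)`, with generators `hgen a = h_a(-1)𝟏` for an orthonormal basis
`h_1, …, h_ℓ` of `𝔥`: the generators have weight one, their modes satisfy the
Heisenberg commutation relations `[h_a(m), h_b(n)] = m δ_{ab} δ_{m+n,0}`, the
conformal vector is `ω = (1/2) ∑_a h_a(-1)²𝟏`, and `V` is spanned by the vectors
`h_{a_1}(-n_1) ⋯ h_{a_k}(-n_k)𝟏`. -/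
structure IsHeisenberg {ℓ : ℕ} (A : VOA V) (hgen : Fin ℓ → V) : Prop where
  wt_one : ∀ a, hgen a ∈ A.wt 1
  heis_comm : ∀ (a b : Fin ℓ) (m n : ℤ),
    A.Y (hgen a) m * A.Y (hgen b) n - A.Y (hgen b) n * A.Y (hgen a) m
      = (if a = b ∧ m + n = 0 then (m : ℂ) else 0) • (1 : Module.End ℂ V)
  omega_eq : A.omega
      = (1 / 2 : ℂ) • ∑ a : Fin ℓ, A.Y (hgen a) (-1) (A.Y (hgen a) (-1) A.one)
  span_words : Submodule.span ℂ
      {v : V | ∃ L : List (Fin ℓ × ℕ+),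
        v = wordAct (fun a k w => A.Y (hgen a) k w) L A.one} = ⊤

/-- `θ` is the automorphism of the free bosonic vertex operator algebra induced
by `-1` on `𝔥`. -/
structure IsThetaAut {ℓ : ℕ} (A : VOA V) (hgen : Fin ℓ → V) (θ : V ≃ₗ[ℂ] V) : Prop where
  map_one : θ A.one = A.one
  map_omega : θ A.omega = A.omega
  map_Y : ∀ (u : V) (n : ℤ) (v : V), θ (A.Y u n v) = A.Y (θ u) n (θ v)
  map_gen : ∀ a, θ (hgen a) = -hgen a
  map_wt : ∀ (k : ℤ) (v : V), v ∈ A.wt k → θ v ∈ A.wt k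

/-- `B` (with underlying space `W`, embedded in `V` by `ι`) is the fixed point
vertex operator subalgebra `V^θ` of the involution `θ`. -/
structure IsFixedSubVOA {W : Type} [AddCommGroup W] [Module ℂ W]
    (A : VOA V) (θ : V ≃ₗ[ℂ] V) (B : VOA W) (ι : W →ₗ[ℂ] V) : Prop where
  inj : Function.Injective ι
  range_eq : LinearMap.range ι
      = Module.End.eigenspace (θ.toLinearMap : Module.End ℂ V) 1
  map_one : ι B.one = A.one
  map_omega : ι B.omega = A.omega
  map_Y : ∀ (u : W) (n : ℤ) (v : W), ι (B.Y u n v) = A.Y (ι u) n (ι v)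
  map_wt : ∀ (k : ℤ) (w : W), w ∈ B.wt k ↔ ι w ∈ A.wt k

/-- `P` is (isomorphic to) the Fock module `M(1,λ)` over the rank `ℓ` Heisenberg
vertex operator algebra: it has a nonzero vector `v₀` with `h_a(n)v₀ = 0` for
`n ≥ 1`, `h_a(0)v₀ = λ_a v₀`, which generates `M` under the creation operators. -/
def IsFockModule {ℓ : ℕ} {M : Type} [AddCommGroup M] [Module ℂ M]
    (A : VOA V) (hgen : Fin ℓ → V) (P : WkMod A M) (lam : Fin ℓ → ℂ) : Prop :=
  ∃ v0 : M, v0 ≠ 0 ∧ (∀ (a : Fin ℓ) (n : ℤ), 1 ≤ n → P.act (hgen a) n v0 = 0) ∧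
    (∀ a : Fin ℓ, P.act (hgen a) 0 v0 = lam a • v0) ∧
    Submodule.span ℂ {w : M | ∃ L : List (Fin ℓ × ℕ+),
      w = wordAct (fun a k x => P.act (hgen a) k x) L v0} = ⊤

/-- A weak `θ`-twisted module (for an involution `θ`): the modes are indexed by
`(1/2)ℤ`, encoded here by doubling (so `act u k` is the mode `u_{k/2}`); on the
eigenspace `θ = (-1)^r` only modes with `k ≡ r (mod 2)` act, and the component
form of the twisted Jacobi identity holds. -/
structure TwMod (A : VOA V) (θ : V ≃ₗ[ℂ] V) (M : Type) [AddCommGroup M]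
    [Module ℂ M] : Type where
  act : V →ₗ[ℂ] ℤ → Module.End ℂ M
  trunc : ∀ (u : V) (w : M), ∃ N : ℤ, ∀ n : ℤ, N ≤ n → act u n w = 0
  vacuum_act : ∀ n : ℤ, act A.one n = if n = -2 then (1 : Module.End ℂ M) else 0
  moding : ∀ (u : V) (r : ℤ), θ u = ((-1 : ℂ) ^ r) • u →
    ∀ k : ℤ, (k - r) % 2 ≠ 0 → act u k = 0
  borcherds : ∀ (u v : V) (r s : ℤ), θ u = ((-1 : ℂ) ^ r) • u →
    θ v = ((-1 : ℂ) ^ s) • v → ∀ (w : M) (p K N : ℤ),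
    ∑ᶠ i : ℕ, ((qchoose ((K : ℚ) / 2) i : ℚ) : ℂ) • act (A.Y u (p + i) v) (K + N - 2 * i) w
      = ∑ᶠ i : ℕ, ((-1 : ℂ) ^ i * zchoose p i) •
          (act u (K + 2 * p - 2 * i) (act v (N + 2 * i) w)
            - ((-1 : ℂ) ^ p) • act v (N + 2 * p - 2 * i) (act u (K + 2 * i) w))

/-- Irreducibility of a twisted module. -/
def TwMod.Irreducible {A : VOA V} {θ : V ≃ₗ[ℂ] V} {M : Type} [AddCommGroup M]
    [Module ℂ M] (T : TwMod A θ M) : Prop :=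
  (∃ w : M, w ≠ 0) ∧
    ∀ U : Submodule ℂ M, (∀ (u : V) (k : ℤ) (w : M), w ∈ U → T.act u k w ∈ U) →
      U = ⊥ ∨ U = ⊤

/-- `T` is (isomorphic to) the canonical irreducible `θ`-twisted module
`𝓗(θ) = S(𝔥 ⊗ t^{-1/2}ℂ[t^{-1/2}])` of the rank `ℓ` free bosonic vertex operator
algebra: it has a nonzero vector killed by all modes `h_a(k/2)`, `k ≥ 1`, which
generates it under the twisted creation operators. -/
def IsCanonicalTwMod {ℓ : ℕ} {M : Type} [AddCommGroup M] [Module ℂ M]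
    (A : VOA V) (hgen : Fin ℓ → V) {θ : V ≃ₗ[ℂ] V} (T : TwMod A θ M) : Prop :=
  ∃ v0 : M, v0 ≠ 0 ∧ (∀ (a : Fin ℓ) (k : ℤ), 1 ≤ k → T.act (hgen a) k v0 = 0) ∧
    Submodule.span ℂ {w : M | ∃ L : List (Fin ℓ × ℕ+),
      w = twWordAct (fun a k x => T.act (hgen a) k x) L v0} = ⊤

/-- `σ` is the canonical involution of the twisted module `𝓗(θ)` (acting by
`(-1)^k` on monomials of length `k`): it is an involution compatible with `θ`
through the twisted action and fixing the lowest weight vectors. -/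
def TwInvolution {ℓ : ℕ} {M : Type} [AddCommGroup M] [Module ℂ M]
    (A : VOA V) (hgen : Fin ℓ → V) {θ : V ≃ₗ[ℂ] V} (T : TwMod A θ M)
    (σ : M ≃ₗ[ℂ] M) : Prop :=
  (∀ w : M, σ (σ w) = w) ∧
  (∀ (u : V) (k : ℤ) (w : M), σ (T.act u k w) = T.act (θ u) k (σ w)) ∧
  (∀ v0 : M, (∀ (a : Fin ℓ) (k : ℤ), 1 ≤ k → T.act (hgen a) k v0 = 0) → σ v0 = v0)

/-- The weak `B = V^θ`-module `Q` "is" the eigenspace `V^{(ε)}` of `θ` on `V`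
(e.g. `𝓗⁺` itself for `ε = 1` and `𝓗⁻` for `ε = -1`), with action obtained by
restricting the vertex operators of `V`. -/
def IsEigenPartModule {W N : Type} [AddCommGroup W] [Module ℂ W]
    [AddCommGroup N] [Module ℂ N] (A : VOA V) (θ : V ≃ₗ[ℂ] V) {B : VOA W}
    (ι : W →ₗ[ℂ] V) (ε : ℂ) (Q : WkMod B N) : Prop :=
  ∃ j : N →ₗ[ℂ] V, Function.Injective j ∧
    LinearMap.range j = Module.End.eigenspace (θ.toLinearMap : Module.End ℂ V) ε ∧
    ∀ (u : W) (n : ℤ) (w : N), j (Q.act u n w) = A.Y (ι u) n (j w)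

/-- The weak `B = V^θ`-module `Q` "is" the eigenspace `𝓗(θ)^{(ε)}` of the
involution `σ` on the twisted module `𝓗(θ)`, with the restricted twisted action
(`u ∈ V^θ` acts by its integral modes). -/
def IsTwEigenPartModule {W MT N : Type} [AddCommGroup W] [Module ℂ W]
    [AddCommGroup MT] [Module ℂ MT] [AddCommGroup N] [Module ℂ N]
    (A : VOA V) {θ : V ≃ₗ[ℂ] V} {B : VOA W} (ι : W →ₗ[ℂ] V)
    (T : TwMod A θ MT) (σ : MT ≃ₗ[ℂ] MT) (ε : ℂ) (Q : WkMod B N) : Prop :=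
  ∃ j : N →ₗ[ℂ] MT, Function.Injective j ∧
    LinearMap.range j = Module.End.eigenspace (σ.toLinearMap : Module.End ℂ MT) ε ∧
    ∀ (u : W) (n : ℤ) (w : N), j (Q.act u n w) = T.act (ι u) (2 * n) (j w)

/-- The weak `B = 𝓗⁺`-module `Q` "is" the restriction to `𝓗⁺` of the Fock module
`M(1,λ)`. -/
def IsFockRestriction {ℓ : ℕ} {W N : Type} [AddCommGroup W] [Module ℂ W]
    [AddCommGroup N] [Module ℂ N] (A : VOA V) (hgen : Fin ℓ → V) {B : VOA W}
    (ι : W →ₗ[ℂ] V) (lam : Fin ℓ → ℂ) (Q : WkMod B N) : Prop :=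
  ∃ P : WkMod A N, IsFockModule A hgen P lam ∧
    ∀ (u : W) (n : ℤ), Q.act u n = P.act (ι u) n

/-- A realization of Zhu's algebra `A(V) = V/O(V)` of a vertex operator algebra
as an abstract associative `ℂ`-algebra `R`. -/
structure ZhuRealization (A : VOA V) (R : Type) [Ring R] [Algebra ℂ R] : Type where
  π : V →ₗ[ℂ] R
  surj : Function.Surjective π
  ker_eq : LinearMap.ker π = A.Osub
  map_star : ∀ u v : V, π (A.star u v) = π u * π v
  map_one : π A.one = 1

/-- The `R = A(V)`-module `M` "is" the top level `N(0)` of the admissible module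
`N`, where `[u] ∈ A(V)` acts on the top level by the zero-mode `o(u)`. -/
def IsTopLevelOf {R : Type} [Ring R] [Algebra ℂ R] {A : VOA V}
    (Z : ZhuRealization A R) {N : Type} [AddCommGroup N] [Module ℂ N]
    (Qa : AdmMod A N) (M : Type) [AddCommGroup M] [Module R M] : Prop :=
  ∃ f : M →+ N, Function.Injective f ∧ (∀ m : M, f m ∈ Qa.gr 0) ∧
    (∀ w ∈ Qa.gr 0, ∃ m : M, f m = w) ∧
    ∀ (u : V) (m : M), f (Z.π u • m) = Qa.toWkMod.oAct u (f m)

/-- Iterated Zhu product of a list of elements (an empty product is `[𝟏]`). -/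
noncomputable def starList (A : VOA V) : List V → V
  | [] => A.one
  | x :: L => A.star x (starList A L)

/-- The linear span of all Zhu-monomials in a set of generators; modulo `O(V)`
this is the subalgebra of `A(V)` generated by the images of the generators. -/
def genMonomials (A : VOA V) (gens : Set V) : Submodule ℂ V :=
  Submodule.span ℂ {w : V | ∃ L : List V, (∀ g ∈ L, g ∈ gens) ∧ w = starList A L}

/-- The subspace `𝓦^α ⊆ 𝓗` spanned by the monomials
`h_{a_1}(-n_1) ⋯ h_{a_k}(-n_k)𝟏` whose number of letters from `𝓗_c` is odd
exactly for `c ∈ α`; thus `wordSpanV A hgen ∅ = 𝓦 = 𝓗₁⁺ ⊗ ⋯ ⊗ 𝓗_ℓ⁺`. -/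
def wordSpanV {ℓ : ℕ} (A : VOA V) (hgen : Fin ℓ → V) (α : Finset (Fin ℓ)) :
    Submodule ℂ V :=
  Submodule.span ℂ {v : V | ∃ L : List (Fin ℓ × ℕ+),
    (∀ c : Fin ℓ, c ∈ α ↔ ¬ Even ((L.map Prod.fst).count c)) ∧
    v = wordAct (fun a k w => A.Y (hgen a) k w) L A.one}

/-- The element `S_{ab}(m,n) = h_a(-m)h_b(-n)𝟏` of `𝓗`. -/
def SV {ℓ : ℕ} (A : VOA V) (hgen : Fin ℓ → V) (a b : Fin ℓ) (m n : ℤ) : V :=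
  A.Y (hgen a) (-m) (A.Y (hgen b) (-n) A.one)

/-- The element `ω_a = (1/2) h_a(-1)²𝟏` of `𝓗⁺`. -/
def omegaV {ℓ : ℕ} (A : VOA V) (hgen : Fin ℓ → V) (a : Fin ℓ) : V :=
  (1 / 2 : ℂ) • SV A hgen a a 1 1

/-- The element `J_a = h_a(-1)⁴𝟏 - 2h_a(-3)h_a(-1)𝟏 + (3/2)h_a(-2)²𝟏` of `𝓗⁺`. -/
def JV {ℓ : ℕ} (A : VOA V) (hgen : Fin ℓ → V) (a : Fin ℓ) : V :=
  A.Y (hgen a) (-1) (A.Y (hgen a) (-1) (A.Y (hgen a) (-1) (A.Y (hgen a) (-1) A.one)))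
    - (2 : ℂ) • SV A hgen a a 3 1 + (3 / 2 : ℂ) • SV A hgen a a 2 2

variable {W : Type} [AddCommGroup W] [Module ℂ W]

/-- `E^u_{ab}` (for `a ≠ b`), as a combination of the `S_{ab}(1,m)`. -/
def EuW {ℓ : ℕ} (s : Fin ℓ → Fin ℓ → ℤ → ℤ → W) (a b : Fin ℓ) : W :=
  (5 : ℂ) • s a b 1 2 + (25 : ℂ) • s a b 1 3 + (36 : ℂ) • s a b 1 4 + (16 : ℂ) • s a b 1 5

/-- `E^t_{ab}` (for `a ≠ b`), as a combination of the `S_{ab}(1,m)`. -/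
def EtW {ℓ : ℕ} (s : Fin ℓ → Fin ℓ → ℤ → ℤ → W) (a b : Fin ℓ) : W :=
  (-16 : ℂ) • ((3 : ℂ) • s a b 1 2 + (14 : ℂ) • s a b 1 3 + (19 : ℂ) • s a b 1 4
    + (8 : ℂ) • s a b 1 5)

/-- `Λ_{ab}` (for `a ≠ b`), as a combination of the `S_{ab}(1,m)`. -/
def LamW {ℓ : ℕ} (s : Fin ℓ → Fin ℓ → ℤ → ℤ → W) (a b : Fin ℓ) : W :=
  (45 : ℂ) • s a b 1 2 + (190 : ℂ) • s a b 1 3 + (240 : ℂ) • s a b 1 4 + (96 : ℂ) • s a b 1 5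

/-- The full setting of the paper: `A = 𝓗` is the rank `ℓ` free bosonic vertex
operator algebra with Heisenberg generators `hgen`, `θ` is its `-1` involution,
and `B = 𝓗⁺` is the fixed point vertex operator subalgebra, embedded by `ι`. -/
structure HeisenbergPlusSetting (ℓ : ℕ) (V W : Type) [AddCommGroup V] [Module ℂ V]
    [AddCommGroup W] [Module ℂ W] : Type where
  A : VOA V
  hgen : Fin ℓ → V
  heis : IsHeisenberg A hgen
  θ : V ≃ₗ[ℂ] V
  thetaAut : IsThetaAut A hgen θ
  B : VOA W
  ι : W →ₗ[ℂ] V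
  fixedSub : IsFixedSubVOA A θ B ι

/-- Bundled weak module over a vertex operator algebra. -/
structure ARep (A : VOA V) : Type 1 where
  carrier : Type
  [acg : AddCommGroup carrier]
  [mod : Module ℂ carrier]
  str : WkMod A carrier

attribute [instance] ARep.acg ARep.mod

/-- Bundled admissible module over a vertex operator algebra. -/
structure BRep (A : VOA V) : Type 1 where
  carrier : Type
  [acg : AddCommGroup carrier]
  [mod : Module ℂ carrier]
  adm : AdmMod A carrier

attribute [instance] BRep.acg BRep.mod

/-- Bundled twisted module over a vertex operator algebra with involution. -/
structure TwRep (A : VOA V) (θ : V ≃ₗ[ℂ] V) : Type 1 where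
  carrier : Type
  [acg : AddCommGroup carrier]
  [mod : Module ℂ carrier]
  str : TwMod A θ carrier

attribute [instance] TwRep.acg TwRep.mod

end


noncomputable section

/-! ### Generalities on binomial coefficients -/

theorem qchoose_absorb (q : ℚ) (n : ℕ) :
    qchoose (q + 1) (n + 1) = qchoose q n * (q + 1) / (n + 1) := by
  induction n with
  | zero => simp [qchoose]
  | succ n ih =>
    rw [qchoose, ih, qchoose]
    push_cast
    have h1 : (n : ℚ) + 1 ≠ 0 := by positivity
    have h2 : (n : ℚ) + 1 + 1 ≠ 0 := by positivity
    field_simp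
    ring

theorem qchoose_pascal (q : ℚ) (n : ℕ) :
    qchoose (q + 1) (n + 1) = qchoose q n + qchoose q (n + 1) := by
  rw [qchoose_absorb, qchoose]
  have h1 : (n : ℚ) + 1 ≠ 0 := by positivity
  field_simp
  ring

theorem zchoose_absorb (m : ℤ) (n : ℕ) :
    zchoose (m + 1) (n + 1) = zchoose m n * ((m : ℂ) + 1) / (n + 1) := by
  unfold zchoose
  have := qchoose_absorb (m : ℚ) n
  push_cast
  rw [this]
  push_cast
  rfl

theorem zchoose_pascal (m : ℤ) (n : ℕ) :
    zchoose (m + 1) (n + 1) = zchoose m n + zchoose m (n + 1) := by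
  unfold zchoose
  have := qchoose_pascal (m : ℚ) n
  push_cast
  rw [this]
  push_cast
  rfl

theorem zchoose_zero_right (m : ℤ) : zchoose m 0 = 1 := by
  simp [zchoose, qchoose]

theorem zchoose_zero_left (n : ℕ) (hn : n ≠ 0) : zchoose 0 n = 0 := by
  have : ∀ n : ℕ, qchoose 0 (n + 1) = 0 := by
    intro n
    induction n with
    | zero => simp [qchoose]
    | succ n ih => rw [qchoose, ih]; simp
  obtain ⟨k, rfl⟩ := Nat.exists_eq_succ_of_ne_zero hn
  simp [zchoose, this]

theorem zchoose_neg_one (n : ℕ) : zchoose (-1) n = (-1) ^ n := by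
  have : ∀ n : ℕ, qchoose (-1) n = (-1) ^ n := by
    intro n
    induction n with
    | zero => simp [qchoose]
    | succ n ih =>
      rw [qchoose, ih]
      have h1 : (n : ℚ) + 1 ≠ 0 := by positivity
      field_simp
      ring
  simp [zchoose, this]

theorem zchoose_one_right (m : ℤ) : zchoose m 1 = m := by
  simp [zchoose, qchoose]

theorem zchoose_two_two : zchoose 2 2 = 1 := by
  simp [zchoose, qchoose]; norm_num

theorem zchoose_two_ge (n : ℕ) : zchoose 2 (n + 3) = 0 := by
  have : ∀ n : ℕ, qchoose 2 (n + 3) = 0 := by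
    intro n
    induction n with
    | zero => simp [qchoose]
    | succ n ih => rw [qchoose, ih]; simp
  simp [zchoose, this]

/-! ### Generalities on vertex operator algebras -/

section general

variable {U : Type} [AddCommGroup U] [Module ℂ U]

theorem VOA.hcomp_same (A : VOA U) {k : ℤ} {u : U} (hu : u ∈ A.wt k) : A.hcomp k u = u := by
  have : A.decompose u = DirectSum.lof ℂ ℤ (fun n => A.wt n) k ⟨u, hu⟩ := by
    unfold VOA.decompose
    rw [LinearEquiv.symm_apply_eq]
    exact (DirectSum.coeLinearMap_lof A.wt k ⟨u, hu⟩).symm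
  unfold VOA.hcomp
  rw [this]
  simp [DirectSum.lof_apply]

theorem VOA.hcomp_ne (A : VOA U) {k j : ℤ} {u : U} (hu : u ∈ A.wt k) (h : j ≠ k) :
    A.hcomp j u = 0 := by
  have : A.decompose u = DirectSum.lof ℂ ℤ (fun n => A.wt n) k ⟨u, hu⟩ := by
    unfold VOA.decompose
    rw [LinearEquiv.symm_apply_eq]
    exact (DirectSum.coeLinearMap_lof A.wt k ⟨u, hu⟩).symm
  unfold VOA.hcomp
  rw [this]
  simp [DirectSum.lof_eq_of, DirectSum.of_eq_of_ne _ _ _ h]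

theorem VOA.hcomp_add (A : VOA U) (k : ℤ) (u v : U) :
    A.hcomp k (u + v) = A.hcomp k u + A.hcomp k v := by
  simp [VOA.hcomp]

theorem VOA.hcomp_smul (A : VOA U) (k : ℤ) (c : ℂ) (u : U) :
    A.hcomp k (c • u) = c • A.hcomp k u := by
  unfold VOA.hcomp
  rw [map_smul]
  rfl

theorem VOA.hcomp_finite (A : VOA U) (u : U) : {k : ℤ | A.hcomp k u ≠ 0}.Finite := by
  classical
  refine (DFinsupp.support (A.decompose u)).finite_toSet.subset ?_
  intro k hk
  simp only [Finset.mem_coe, DFinsupp.mem_support_toFun, ne_eq]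
  intro h
  apply hk
  show ((A.decompose u k : A.wt k) : U) = 0
  have h' : (A.decompose u k) = 0 := h
  rw [h']; rfl

/-- A sequence of vectors vanishing eventually has finite support. -/
theorem finite_support_of_eventually {X : Type} [AddCommGroup X] {f : ℕ → X} (N : ℕ) (h : ∀ i, N ≤ i → f i = 0) :
    (Function.support f).Finite := by
  refine (Set.finite_lt_nat N).subset ?_
  intro i hi
  by_contra hc
  exact hi (h i (not_lt.mp hc))

theorem VOA.finite_modes (A : VOA U) (c : ℕ → ℂ) (u v : U) (p : ℤ) :
    (Function.support (fun i : ℕ => c i • A.Y u ((i : ℤ) - p) v)).Finite := by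
  obtain ⟨N, hN⟩ := A.trunc u v
  refine finite_support_of_eventually (N + p).toNat ?_
  intro i hi
  have : N ≤ (i : ℤ) - p := by omega
  simp [hN _ this]

theorem VOA.mulAux_add (A : VOA U) (k : ℤ) (u u' v : U) :
    A.mulAux k (u + u') v = A.mulAux k u v + A.mulAux k u' v := by
  unfold VOA.mulAux
  rw [← finsum_add_distrib (A.finite_modes _ u v 1) (A.finite_modes _ u' v 1)]
  simp

theorem VOA.mulAux_smul (A : VOA U) (k : ℤ) (c : ℂ) (u v : U) :
    A.mulAux k (c • u) v = c • A.mulAux k u v := by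
  unfold VOA.mulAux
  rw [smul_finsum]
  refine finsum_congr fun i => ?_
  simp [smul_comm c]

theorem VOA.mulAux_zero (A : VOA U) (k : ℤ) (v : U) : A.mulAux k 0 v = 0 := by
  simp [VOA.mulAux]

theorem VOA.star_finite (A : VOA U) (u v : U) :
    (Function.support (fun k : ℤ => A.mulAux k (A.hcomp k u) v)).Finite := by
  refine (A.hcomp_finite u).subset ?_
  intro k hk h
  apply hk
  show A.mulAux k (A.hcomp k u) v = 0
  rw [h, A.mulAux_zero]

theorem VOA.star_add (A : VOA U) (u u' v : U) :
    A.star (u + u') v = A.star u v + A.star u' v := by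
  unfold VOA.star
  rw [← finsum_add_distrib (A.star_finite u v) (A.star_finite u' v)]
  simp [VOA.hcomp_add, VOA.mulAux_add]

theorem VOA.star_smul (A : VOA U) (c : ℂ) (u v : U) :
    A.star (c • u) v = c • A.star u v := by
  unfold VOA.star
  rw [smul_finsum]
  simp [VOA.hcomp_smul, VOA.mulAux_smul]

theorem VOA.star_hom (A : VOA U) {k : ℤ} {u : U} (hu : u ∈ A.wt k) (v : U) :
    A.star u v = A.mulAux k u v := by
  unfold VOA.star
  rw [finsum_eq_single _ k]
  · rw [A.hcomp_same hu]
  · intro j hj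
    rw [A.hcomp_ne hu hj, A.mulAux_zero]

/-- A finite sum with weight-two binomial coefficients. -/
theorem finsum_zchoose_two (f : ℕ → U) :
    ∑ᶠ i : ℕ, zchoose 2 i • f i = f 0 + (2 : ℂ) • f 1 + f 2 := by
  rw [finsum_eq_sum_of_support_subset (s := Finset.range 3)]
  · simp [Finset.sum_range_succ, zchoose_zero_right, zchoose_one_right, zchoose_two_two]
  · intro i hi
    by_contra hc
    apply hi
    have : 3 ≤ i := by simpa using hc
    obtain ⟨j, rfl⟩ := Nat.exists_eq_add_of_le' this
    simp [zchoose_two_ge]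

theorem VOA.mulAux_two (A : VOA U) (u v : U) :
    A.mulAux 2 u v = A.Y u (-1) v + (2 : ℂ) • A.Y u 0 v + A.Y u 1 v := by
  unfold VOA.mulAux
  rw [finsum_zchoose_two (fun i => A.Y u ((i : ℤ) - 1) v)]
  norm_num

theorem VOA.circAux_two (A : VOA U) (u v : U) :
    A.circAux 2 u v = A.Y u (-2) v + (2 : ℂ) • A.Y u (-1) v + A.Y u 0 v := by
  unfold VOA.circAux
  rw [finsum_zchoose_two (fun i => A.Y u ((i : ℤ) - 2) v)]
  norm_num

theorem VOA.circAux_one (A : VOA U) (k : ℤ) (u : U) :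
    A.circAux k u A.one = A.Y u (-2) A.one + (k : ℂ) • u := by
  unfold VOA.circAux
  rw [finsum_eq_sum_of_support_subset (s := Finset.range 2)]
  · simp [Finset.sum_range_succ, zchoose_zero_right, zchoose_one_right, A.create]
  · intro i hi
    by_contra hc
    apply hi
    have : 2 ≤ i := by simpa [Nat.lt_iff_add_one_le] using hc
    have h0 : (0 : ℤ) ≤ (i : ℤ) - 2 := by omega
    simp [A.create_ge _ _ h0]

/-- The zero mode `u_0` is a derivation. -/
theorem VOA.zero_mode_comm (A : VOA U) (u v w : U) (n : ℤ) :
    A.Y (A.Y u 0 v) n w = A.Y u 0 (A.Y v n w) - A.Y v n (A.Y u 0 w) := by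
  have h := A.borcherds u v w 0 0 n
  rw [finsum_eq_single _ 0, finsum_eq_single _ 0] at h
  · simpa [zchoose_zero_right] using h
  · intro i hi
    simp [zchoose_zero_left i hi]
  · intro i hi
    simp [zchoose_zero_left i hi]

theorem VOA.L_one (A : VOA U) : A.Y A.omega 0 A.one = 0 := A.create_ge _ _ le_rfl

theorem VOA.mode_neg_two (A : VOA U) (u : U) : A.Y u (-2) A.one = A.Y A.omega 0 u := by
  have h := A.translation u (-1)
  have h2 := A.create (A.Y A.omega 0 u)
  rw [h] at h2
  simpa using h2

/-- The commutator of `L(-1)` with a mode. -/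
theorem VOA.L_mode (A : VOA U) (u v : U) (n : ℤ) :
    A.Y A.omega 0 (A.Y u n v) = A.Y u n (A.Y A.omega 0 v) - (n : ℂ) • A.Y u (n - 1) v := by
  have h := A.zero_mode_comm A.omega u v n
  rw [A.translation] at h
  have h' : A.Y A.omega 0 (A.Y u n v)
      = (-(n : ℂ)) • A.Y u (n - 1) v + A.Y u n (A.Y A.omega 0 v) := by
    have := congrArg (fun x => x + A.Y u n (A.Y A.omega 0 v)) h
    simpa using this.symm
  rw [h']
  module

/-- `L(-1)u + L(0)u ∈ O(V)`. -/
theorem VOA.L_mem (A : VOA U) {k : ℤ} {u : U} (hu : u ∈ A.wt k) :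
    A.Y A.omega 0 u + (k : ℂ) • u ∈ A.Osub := by
  refine Submodule.subset_span ⟨k, u, A.one, hu, ?_⟩
  rw [A.circAux_one, A.mode_neg_two]

theorem VOA.mode_one_mem (A : VOA U) {w : ℤ} {x : U} (hx : x ∈ A.wt w) (j : ℕ) :
    A.Y x (-1 - (j : ℤ)) A.one - ((-1 : ℂ) ^ j * zchoose (w + j - 1) j) • x ∈ A.Osub := by
  induction j with
  | zero => simp [zchoose_zero_right, A.create]
  | succ j ih =>
    have hy : A.Y x (-1 - (j : ℤ)) A.one ∈ A.wt (w + j) := by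
      have := A.mode_wt w x hx 0 (-1 - (j : ℤ)) A.one A.one_wt
      convert this using 2
      ring
    have h1 := A.L_mem hy
    rw [A.L_mode, A.L_one, map_zero, zero_sub] at h1
    have h2 : A.Y x (-1 - ((j + 1 : ℕ) : ℤ)) A.one
        - ((-1 : ℂ) ^ (j + 1) * zchoose (w + (j + 1 : ℕ) - 1) (j + 1)) • x
        = (1 / ((j : ℂ) + 1)) • (-(((-1 - (j : ℤ) : ℤ) : ℂ) • A.Y x (-1 - (j : ℤ) - 1) A.one)
          + ((w + j : ℤ) : ℂ) • A.Y x (-1 - (j : ℤ)) A.one)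
          - ((w + j : ℂ) / (j + 1)) • (A.Y x (-1 - (j : ℤ)) A.one
            - ((-1 : ℂ) ^ j * zchoose (w + j - 1) j) • x) := by
      have e1 : w + ((j + 1 : ℕ) : ℤ) - 1 = (w + j - 1) + 1 := by push_cast; ring
      have e2 : (-1 - ((j + 1 : ℕ) : ℤ)) = -1 - (j : ℤ) - 1 := by push_cast; ring
      rw [e1, zchoose_absorb, e2]
      have h3 : (j : ℂ) + 1 ≠ 0 := by exact_mod_cast Nat.succ_ne_zero j
      generalize A.Y x (-1 - (j : ℤ) - 1) A.one = X
      generalize A.Y x (-1 - (j : ℤ)) A.one = Y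
      push_cast
      match_scalars <;> field_simp <;> ring
    rw [h2]
    exact A.Osub.sub_mem (A.Osub.smul_mem _ h1) (A.Osub.smul_mem _ ih)

/-- Skew symmetry for vertex operators. -/
theorem VOA.skew (A : VOA U) (u v : U) (p : ℤ) :
    A.Y v p u = ∑ᶠ i : ℕ, (-((-1 : ℂ) ^ p) * (-1) ^ i) •
      A.Y (A.Y u (p + i) v) (-1 - (i : ℤ)) A.one := by
  have h := A.borcherds u v A.one p (-1) 0
  rw [finsum_eq_single (fun i : ℕ => ((-1 : ℂ) ^ i * zchoose p i) •
          (A.Y u (-1 + p - i) (A.Y v (0 + i) A.one)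
            - ((-1 : ℂ) ^ p) • A.Y v (0 + p - i) (A.Y u (-1 + i) A.one))) 0] at h
  · simp only [zchoose_zero_right, Nat.cast_zero, add_zero, pow_zero, one_mul, one_smul,
      A.create, zero_add, sub_zero, A.create_ge v 0 le_rfl, map_zero, zero_sub,
      zchoose_neg_one] at h
    have hp : ((-1 : ℂ) ^ p) * ((-1 : ℂ) ^ p) = 1 := by
      rw [← zpow_add₀ (by norm_num)]
      exact Even.neg_one_zpow ⟨p, rfl⟩
    have h2 : A.Y v p u = (-((-1 : ℂ) ^ p)) • (-((-1 : ℂ) ^ p • A.Y v p u)) := by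
      rw [← smul_neg, smul_smul]
      simp [hp]
    rw [h2, ← h, smul_finsum]
    refine finsum_congr fun i => ?_
    rw [smul_smul]
  · intro i hi
    have h1 : A.Y v (0 + (i : ℤ)) A.one = 0 := A.create_ge _ _ (by omega)
    have h2 : A.Y u (-1 + (i : ℤ)) A.one = 0 := A.create_ge _ _ (by omega)
    rw [h1, h2]
    simp

/-- Finite sums of elements of a submodule. -/
theorem finsum_mem_submodule (O : Submodule ℂ U) (f : ℕ → U) (h : ∀ i, f i ∈ O) :
    ∑ᶠ i, f i ∈ O := by
  exact finsum_induction (fun x => x ∈ O) O.zero_mem (fun _ _ => O.add_mem) h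

theorem VOA.skew_mem (A : VOA U) {k l : ℤ} {u v : U} (hu : u ∈ A.wt k) (hv : v ∈ A.wt l)
    (p : ℤ) :
    A.Y v p u - (-((-1 : ℂ) ^ p)) • ∑ᶠ i : ℕ, zchoose (k + l - p - 2) i • A.Y u ((i : ℤ) + p) v
      ∈ A.Osub := by
  rw [A.skew, smul_finsum, ← finsum_sub_distrib]
  · refine finsum_mem_submodule _ _ fun i => ?_
    have hw := A.mode_wt k u hu l (p + i) v hv
    have h := A.mode_one_mem hw i
    have e : l + k - (p + i) - 1 + i - 1 = k + l - p - 2 := by ring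
    rw [e] at h
    have h2 := A.Osub.smul_mem (-((-1 : ℂ) ^ p) * (-1) ^ i) h
    rw [smul_sub, smul_smul] at h2
    rw [smul_smul]
    convert h2 using 3
    · have : ((-1 : ℂ) ^ i) * ((-1 : ℂ) ^ i) = 1 := by
        rw [← mul_pow]; simp
      linear_combination ((-1 : ℂ) ^ p) * zchoose (k + l - p - 2) i * this
    · rw [add_comm]
  · obtain ⟨N, hN⟩ := A.trunc u v
    refine finite_support_of_eventually (N - p).toNat ?_
    intro i hi
    have : N ≤ p + (i : ℤ) := by omega
    simp [hN _ this]
  · obtain ⟨N, hN⟩ := A.trunc u v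
    refine finite_support_of_eventually (N - p).toNat ?_
    intro i hi
    have : N ≤ (i : ℤ) + p := by omega
    simp [hN _ this]

/-- Right multiplication by a vector of weight two in Zhu's algebra. -/
theorem VOA.star_right (A : VOA U) {k : ℤ} {u v : U} (hu : u ∈ A.wt k) (hv : v ∈ A.wt 2) :
    A.star u v - (A.Y v (-1) u + A.Y v 0 u) ∈ A.Osub := by
  have h1 := A.skew_mem hu hv (-1)
  have h0 := A.skew_mem hu hv 0
  have key : A.star u v = (-((-1 : ℂ) ^ (-1 : ℤ))) •
        ∑ᶠ i : ℕ, zchoose (k + 2 - (-1) - 2) i • A.Y u ((i : ℤ) + (-1)) v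
      + (-((-1 : ℂ) ^ (0 : ℤ))) • ∑ᶠ i : ℕ, zchoose (k + 2 - 0 - 2) i • A.Y u ((i : ℤ) + 0) v := by
    rw [A.star_hom hu]
    unfold VOA.mulAux
    obtain ⟨N, hN⟩ := A.trunc u v
    set M := (N + 1).toNat with hM
    have hz : ∀ i : ℕ, M ≤ i → A.Y u (i : ℤ) v = 0 := fun i hi => hN _ (by omega)
    have hz' : ∀ i : ℕ, M + 1 ≤ i → A.Y u ((i : ℤ) - 1) v = 0 := fun i hi => hN _ (by omega)
    have ss : ∀ (n : ℕ) (f : ℕ → U), (∀ i, n ≤ i → f i = 0) →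
        ∑ᶠ i, f i = ∑ i ∈ Finset.range n, f i := by
      intro n f hf
      refine finsum_eq_sum_of_support_subset _ ?_
      intro i hi
      by_contra hc
      exact hi (hf i (by simpa using hc))
    rw [ss (M + 1), ss (M + 1), ss M, Finset.sum_range_succ', Finset.sum_range_succ']
    · have e1 : k + 2 - (-1) - 2 = k + 1 := by ring
      have e0 : k + 2 - 0 - 2 = k := by ring
      rw [e1, e0]
      have e3 : ∀ i : ℕ, ((i + 1 : ℕ) : ℤ) + (-1) = (i : ℤ) := by intro i; push_cast; ring
      have e4 : ∀ i : ℕ, ((i + 1 : ℕ) : ℤ) - 1 = (i : ℤ) := by intro i; push_cast; ring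
      simp only [zchoose_pascal, e3, e4, add_zero, add_smul, Finset.sum_add_distrib,
        zchoose_zero_right]
      simp
      abel
    · intro i hi; simp [hz i hi]
    · intro i hi
      have := hz' i hi
      rw [sub_eq_add_neg] at this
      simp [this]
    · intro i hi; simp [hz' i hi]
  rw [key]
  have := A.Osub.neg_mem (A.Osub.add_mem h1 h0)
  convert this using 1
  abel

end general


/-! ### Words in the Heisenberg vertex operator algebra -/

section words

variable {U : Type} [AddCommGroup U] [Module ℂ U] {ℓ : ℕ}

/-- The word `h_x(-i) h_y(-j) 𝟏`. -/
def wd2 (A : VOA U) (h : Fin ℓ → U) (x : Fin ℓ) (i : ℕ) (y : Fin ℓ) (j : ℕ) : U :=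
  A.Y (h x) (-(i : ℤ)) (A.Y (h y) (-(j : ℤ)) A.one)

/-- The word `h_x(-i) h_y(-j) h_z(-k) h_w(-l) 𝟏`. -/
def wd4 (A : VOA U) (h : Fin ℓ → U) (x : Fin ℓ) (i : ℕ) (y : Fin ℓ) (j : ℕ)
    (z : Fin ℓ) (k : ℕ) (w : Fin ℓ) (l : ℕ) : U :=
  A.Y (h x) (-(i : ℤ)) (A.Y (h y) (-(j : ℤ)) (wd2 A h z k w l))

variable {A : VOA U} {h : Fin ℓ → U}

theorem heis_apply (H : IsHeisenberg A h) (x y : Fin ℓ) (m n : ℤ) (v : U) :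
    A.Y (h x) m (A.Y (h y) n v) = A.Y (h y) n (A.Y (h x) m v)
      + (if x = y ∧ m + n = 0 then (m : ℂ) else 0) • v := by
  have h1 := congrArg (fun f : Module.End ℂ U => f v) (H.heis_comm x y m n)
  simp only [LinearMap.sub_apply, Module.End.mul_apply, LinearMap.smul_apply,
    Module.End.one_apply] at h1
  rw [← h1]
  abel

theorem heis_creation (H : IsHeisenberg A h) (x y : Fin ℓ) (i j : ℕ) (v : U) :
    A.Y (h x) (-(i : ℤ)) (A.Y (h y) (-(j : ℤ)) v)
      = A.Y (h y) (-(j : ℤ)) (A.Y (h x) (-(i : ℤ)) v) := by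
  rw [heis_apply H]
  have : (if x = y ∧ -(i : ℤ) + -(j : ℤ) = 0 then ((-(i : ℤ) : ℤ) : ℂ) else 0) = 0 := by
    split_ifs with hc
    · have : (i : ℤ) = 0 := by omega
      simp [this]
    · rfl
  rw [this]
  simp

theorem wd2_swap (H : IsHeisenberg A h) (x : Fin ℓ) (i : ℕ) (y : Fin ℓ) (j : ℕ) :
    wd2 A h x i y j = wd2 A h y j x i := heis_creation H x y i j A.one

theorem wd4_swap12 (H : IsHeisenberg A h) (x : Fin ℓ) (i : ℕ) (y : Fin ℓ) (j : ℕ)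
    (z : Fin ℓ) (k : ℕ) (w : Fin ℓ) (l : ℕ) :
    wd4 A h x i y j z k w l = wd4 A h y j x i z k w l := heis_creation H x y i j _

theorem wd4_swap23 (H : IsHeisenberg A h) (x : Fin ℓ) (i : ℕ) (y : Fin ℓ) (j : ℕ)
    (z : Fin ℓ) (k : ℕ) (w : Fin ℓ) (l : ℕ) :
    wd4 A h x i y j z k w l = wd4 A h x i z k y j w l := by
  unfold wd4 wd2
  rw [heis_creation H y z]

theorem wd4_swap34 (H : IsHeisenberg A h) (x : Fin ℓ) (i : ℕ) (y : Fin ℓ) (j : ℕ)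
    (z : Fin ℓ) (k : ℕ) (w : Fin ℓ) (l : ℕ) :
    wd4 A h x i y j z k w l = wd4 A h x i y j w l z k := by
  unfold wd4
  rw [wd2_swap H]

theorem annih_wd2 (H : IsHeisenberg A h) (y z w : Fin ℓ) (k i j : ℕ) :
    A.Y (h y) (k : ℤ) (wd2 A h z i w j)
      = (if y = z ∧ k = i then (i : ℂ) else 0) • A.Y (h w) (-(j : ℤ)) A.one
        + (if y = w ∧ k = j then (j : ℂ) else 0) • A.Y (h z) (-(i : ℤ)) A.one := by
  unfold wd2
  rw [heis_apply H, heis_apply H y w, A.create_ge _ _ (Int.natCast_nonneg k), map_zero, zero_add,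
    map_smul, add_comm]
  congr 2
  · by_cases hk : k = i
    · subst hk; simp
    · have : ¬ ((k : ℤ) + -(i : ℤ) = 0) := by omega
      simp [hk, this]
  · by_cases hk : k = j
    · subst hk; simp
    · have : ¬ ((k : ℤ) + -(j : ℤ) = 0) := by omega
      simp [hk, this]

/-- The modes of `h_x(-1)h_y(-1)𝟏`. -/
theorem mode_quad (x y : Fin ℓ) (n : ℤ) (v : U) :
    A.Y (SV A h x y 1 1) n v = ∑ᶠ t : ℕ,
      (A.Y (h x) (-1 - (t : ℤ)) (A.Y (h y) (n + t) v)
        + A.Y (h y) (n - 1 - t) (A.Y (h x) (t : ℤ) v)) := by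
  have hb := A.borcherds (h x) (h y) v (-1) 0 n
  rw [finsum_eq_single _ 0] at hb
  · have e : SV A h x y 1 1 = A.Y (h x) (-1) (h y) := by
      unfold SV
      rw [A.create]
    rw [e]
    simp only [zchoose_zero_right, one_smul, Nat.cast_zero, add_zero, sub_zero, zero_add] at hb
    rw [hb]
    refine finsum_congr fun t => ?_
    rw [zchoose_neg_one, ← mul_pow]
    simp [sub_eq_add_neg]
  · intro i hi
    simp [zchoose_zero_left i hi]

theorem mode_quad_wd2 (H : IsHeisenberg A h) (x y z w : Fin ℓ) (e i j : ℕ)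
    (hi : 1 ≤ i) (hj : 1 ≤ j) :
    A.Y (SV A h x y 1 1) (1 - (e : ℤ)) (wd2 A h z i w j)
      = (∑ t ∈ Finset.range (e - 1), wd4 A h x (t + 1) y (e - 1 - t) z i w j)
        + ((if y = z then (i : ℂ) else 0) • wd2 A h x (i + e) w j
        + (if y = w then (j : ℂ) else 0) • wd2 A h x (j + e) z i
        + (if x = z then (i : ℂ) else 0) • wd2 A h y (i + e) w j
        + (if x = w then (j : ℂ) else 0) • wd2 A h y (j + e) z i) := by
  rw [mode_quad]
  have key : ∀ t : ℕ, A.Y (h x) (-1 - (t : ℤ)) (A.Y (h y) (1 - (e : ℤ) + t) (wd2 A h z i w j))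
        + A.Y (h y) (1 - (e : ℤ) - 1 - t) (A.Y (h x) (t : ℤ) (wd2 A h z i w j))
      = (if t < e - 1 then wd4 A h x (t + 1) y (e - 1 - t) z i w j else 0)
        + ((if t = i + e - 1 then (if y = z then (i : ℂ) else 0) • wd2 A h x (i + e) w j else 0)
        + (if t = j + e - 1 then (if y = w then (j : ℂ) else 0) • wd2 A h x (j + e) z i else 0)
        + (if t = i then (if x = z then (i : ℂ) else 0) • wd2 A h y (i + e) w j else 0)
        + (if t = j then (if x = w then (j : ℂ) else 0) • wd2 A h y (j + e) z i else 0)) := by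
    intro t
    have p2 : A.Y (h y) (1 - (e : ℤ) - 1 - t) (A.Y (h x) (t : ℤ) (wd2 A h z i w j))
        = (if t = i then (if x = z then (i : ℂ) else 0) • wd2 A h y (i + e) w j else 0)
        + (if t = j then (if x = w then (j : ℂ) else 0) • wd2 A h y (j + e) z i else 0) := by
      rw [annih_wd2 H, map_add, map_smul, map_smul]
      congr 1
      · by_cases ht : t = i
        · subst ht
          have : (1 - (e : ℤ) - 1 - t) = -((t + e : ℕ) : ℤ) := by push_cast; ring
          rw [this]
          simp [wd2]
        · simp [ht]
      · by_cases ht : t = j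
        · subst ht
          have : (1 - (e : ℤ) - 1 - t) = -((t + e : ℕ) : ℤ) := by push_cast; ring
          rw [this]
          simp [wd2]
        · simp [ht]
    have p1 : A.Y (h x) (-1 - (t : ℤ)) (A.Y (h y) (1 - (e : ℤ) + t) (wd2 A h z i w j))
        = (if t < e - 1 then wd4 A h x (t + 1) y (e - 1 - t) z i w j else 0)
        + ((if t = i + e - 1 then (if y = z then (i : ℂ) else 0) • wd2 A h x (i + e) w j else 0)
        + (if t = j + e - 1 then (if y = w then (j : ℂ) else 0) • wd2 A h x (j + e) z i
            else 0)) := by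
      have ex : (-1 - (t : ℤ)) = -((t + 1 : ℕ) : ℤ) := by push_cast; ring
      by_cases ht : t < e - 1
      · have ey : (1 - (e : ℤ) + t) = -((e - 1 - t : ℕ) : ℤ) := by omega
        have h1 : ¬ (t = i + e - 1) := by omega
        have h2 : ¬ (t = j + e - 1) := by omega
        rw [ex, ey]
        simp [ht, h1, h2, wd4]
      · obtain ⟨k, hk⟩ : ∃ k : ℕ, (1 - (e : ℤ) + t) = (k : ℤ) := ⟨t + 1 - e, by omega⟩
        rw [hk, annih_wd2 H, map_add, map_smul, map_smul, if_neg ht, zero_add]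
        congr 1
        · by_cases hki : k = i
          · have h1 : t = i + e - 1 := by omega
            have h2 : t + 1 = i + e := by omega
            rw [ex, h2, if_pos h1]
            simp [wd2, hki]
          · have h1 : ¬ (t = i + e - 1) := by omega
            simp [hki, h1]
        · by_cases hki : k = j
          · have h1 : t = j + e - 1 := by omega
            have h2 : t + 1 = j + e := by omega
            rw [ex, h2, if_pos h1]
            simp [wd2, hki]
          · have h1 : ¬ (t = j + e - 1) := by omega
            simp [hki, h1]
    rw [p1, p2]
    abel
  rw [finsum_congr key, finsum_eq_sum_of_support_subset (s := Finset.range (i + j + e + 1))]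
  · simp only [Finset.sum_add_distrib, Finset.sum_ite_eq', Finset.mem_range]
    have m1 : i + e - 1 < i + j + e + 1 := by omega
    have m2 : j + e - 1 < i + j + e + 1 := by omega
    have m3 : i < i + j + e + 1 := by omega
    have m4 : j < i + j + e + 1 := by omega
    simp only [m1, m2, m3, m4, if_true]
    congr 1
    rw [← Finset.sum_filter]
    refine Finset.sum_congr ?_ fun _ _ => rfl
    ext t
    simp only [Finset.mem_filter, Finset.mem_range]
    omega
  · intro t ht
    by_contra hc
    apply ht
    have hc' : ¬ (t < i + j + e + 1) := by simpa using hc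
    have m0 : ¬ (t < e - 1) := by omega
    have m1 : ¬ (t = i + e - 1) := by omega
    have m2 : ¬ (t = j + e - 1) := by omega
    have m3 : ¬ (t = i) := by omega
    have m4 : ¬ (t = j) := by omega
    simp only [m0, m1, m2, m3, m4, if_false, add_zero]

/-- `L(-1)` on words. -/
theorem L_wd2 (x y : Fin ℓ) (i j : ℕ) :
    A.Y A.omega 0 (wd2 A h x i y j)
      = (i : ℂ) • wd2 A h x (i + 1) y j + (j : ℂ) • wd2 A h x i y (j + 1) := by
  unfold wd2
  have e : ∀ i : ℕ, -(i : ℤ) - 1 = -((i + 1 : ℕ) : ℤ) := by intro i; push_cast; ring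
  rw [A.L_mode, A.L_mode, A.L_one, e, e]
  simp
  abel

theorem L_wd4 (x y z w : Fin ℓ) (i j k l : ℕ) :
    A.Y A.omega 0 (wd4 A h x i y j z k w l)
      = (i : ℂ) • wd4 A h x (i + 1) y j z k w l + (j : ℂ) • wd4 A h x i y (j + 1) z k w l
        + (k : ℂ) • wd4 A h x i y j z (k + 1) w l + (l : ℂ) • wd4 A h x i y j z k w (l + 1) := by
  unfold wd4
  have e : ∀ i : ℕ, -(i : ℤ) - 1 = -((i + 1 : ℕ) : ℤ) := by intro i; push_cast; ring
  rw [A.L_mode, A.L_mode, L_wd2, e, e]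
  simp
  abel

theorem wt_cons (H : IsHeisenberg A h) (x : Fin ℓ) (i : ℕ) {m : ℤ} {v : U} (hv : v ∈ A.wt m) :
    A.Y (h x) (-(i : ℤ)) v ∈ A.wt (i + m) := by
  have := A.mode_wt 1 (h x) (H.wt_one x) m (-(i : ℤ)) v hv
  convert this using 2
  ring

theorem wt_wd2 (H : IsHeisenberg A h) (x y : Fin ℓ) (i j : ℕ) :
    wd2 A h x i y j ∈ A.wt (i + j) := by
  have := wt_cons H x i (wt_cons H y j A.one_wt)
  unfold wd2
  simpa using this

theorem wt_wd4 (H : IsHeisenberg A h) (x y z w : Fin ℓ) (i j k l : ℕ) :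
    wd4 A h x i y j z k w l ∈ A.wt (i + j + k + l) := by
  have := wt_cons H x i (wt_cons H y j (wt_wd2 H z w k l))
  unfold wd4
  convert this using 2
  ring

theorem SV_eq_wd2 (x y : Fin ℓ) (i j : ℕ) :
    SV A h x y (i : ℤ) (j : ℤ) = wd2 A h x i y j := rfl

theorem theta_cons {θ : U ≃ₗ[ℂ] U} (T : IsThetaAut A h θ) (x : Fin ℓ) (n : ℤ) (v : U) :
    θ (A.Y (h x) n v) = - A.Y (h x) n (θ v) := by
  rw [T.map_Y, T.map_gen]
  simp

theorem theta_wd4 {θ : U ≃ₗ[ℂ] U} (T : IsThetaAut A h θ) (x y z w : Fin ℓ) (i j k l : ℕ) :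
    θ (wd4 A h x i y j z k w l) = wd4 A h x i y j z k w l := by
  unfold wd4 wd2
  simp only [theta_cons T, map_neg, neg_neg, T.map_one]

theorem theta_wd2 {θ : U ≃ₗ[ℂ] U} (T : IsThetaAut A h θ) (x y : Fin ℓ) (i j : ℕ) :
    θ (wd2 A h x i y j) = wd2 A h x i y j := by
  unfold wd2
  simp only [theta_cons T, map_neg, neg_neg, T.map_one]

end words

/-! ### Relations modulo `O(𝓗⁺)` -/

section relations

variable {ℓ : ℕ} {V W : Type} [AddCommGroup V] [Module ℂ V] [AddCommGroup W] [Module ℂ W]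

/-- The image of `O(𝓗⁺)` in `𝓗`. -/
def OV (S : HeisenbergPlusSetting ℓ V W) : Submodule ℂ V := S.B.Osub.map S.ι

theorem mem_OV (S : HeisenbergPlusSetting ℓ V W) (w : W) : S.ι w ∈ OV S ↔ w ∈ S.B.Osub := by
  unfold OV
  constructor
  · rintro ⟨x, hx, hxw⟩
    rwa [← S.fixedSub.inj hxw]
  · intro hw
    exact ⟨w, hw, rfl⟩

theorem exists_lift (S : HeisenbergPlusSetting ℓ V W) {v : V} (hv : S.θ v = v) :
    ∃ w : W, S.ι w = v := by
  have : v ∈ LinearMap.range S.ι := by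
    rw [S.fixedSub.range_eq, Module.End.mem_eigenspace_iff]
    simpa using hv
  exact this

theorem D_mem (S : HeisenbergPlusSetting ℓ V W) {v : V} {k : ℤ} (hv : S.θ v = v)
    (hk : v ∈ S.A.wt k) : S.A.Y S.A.omega 0 v + (k : ℂ) • v ∈ OV S := by
  obtain ⟨w, rfl⟩ := exists_lift S hv
  have h1 := S.B.L_mem ((S.fixedSub.map_wt k w).2 hk)
  rw [← mem_OV, map_add, S.fixedSub.map_Y, S.fixedSub.map_omega, map_smul] at h1
  exact h1

theorem C_mem (S : HeisenbergPlusSetting ℓ V W) {u v : V} (hu : S.θ u = u)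
    (hk : u ∈ S.A.wt 2) (hv : S.θ v = v) :
    S.A.Y u (-2) v + (2 : ℂ) • S.A.Y u (-1) v + S.A.Y u 0 v ∈ OV S := by
  obtain ⟨u, rfl⟩ := exists_lift S hu
  obtain ⟨v, rfl⟩ := exists_lift S hv
  have h1 : S.B.circAux 2 u v ∈ S.B.Osub :=
    Submodule.subset_span ⟨2, u, v, (S.fixedSub.map_wt 2 u).2 hk, rfl⟩
  rw [← mem_OV, S.B.circAux_two] at h1
  simpa only [map_add, map_smul, S.fixedSub.map_Y] using h1

/-- The class of a two letter word in `A(𝓗⁺)`. -/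
def g2 (S : HeisenbergPlusSetting ℓ V W) (x : Fin ℓ) (i : ℕ) (y : Fin ℓ) (j : ℕ) : V ⧸ OV S :=
  (OV S).mkQ (wd2 S.A S.hgen x i y j)

/-- The class of a four letter word in `A(𝓗⁺)`. -/
def f4 (S : HeisenbergPlusSetting ℓ V W) (x : Fin ℓ) (i : ℕ) (y : Fin ℓ) (j : ℕ)
    (z : Fin ℓ) (k : ℕ) (w : Fin ℓ) (l : ℕ) : V ⧸ OV S :=
  (OV S).mkQ (wd4 S.A S.hgen x i y j z k w l)

variable (S : HeisenbergPlusSetting ℓ V W)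

theorem relD2 (x y : Fin ℓ) (i j : ℕ) :
    (i : ℂ) • g2 S x (i + 1) y j + (j : ℂ) • g2 S x i y (j + 1)
      + ((i : ℂ) + (j : ℂ)) • g2 S x i y j = 0 := by
  have h1 := D_mem S (theta_wd2 S.thetaAut x y i j) (wt_wd2 S.heis x y i j)
  rw [L_wd2] at h1
  have h2 := (Submodule.Quotient.mk_eq_zero _).2 h1
  simpa [g2] using h2

theorem relD4 (x y z w : Fin ℓ) (i j k l : ℕ) :
    (i : ℂ) • f4 S x (i + 1) y j z k w l + (j : ℂ) • f4 S x i y (j + 1) z k w l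
        + (k : ℂ) • f4 S x i y j z (k + 1) w l + (l : ℂ) • f4 S x i y j z k w (l + 1)
      + ((i : ℂ) + (j : ℂ) + (k : ℂ) + (l : ℂ)) • f4 S x i y j z k w l = 0 := by
  have h1 := D_mem S (theta_wd4 S.thetaAut x y z w i j k l) (wt_wd4 S.heis x y z w i j k l)
  rw [L_wd4] at h1
  have h2 := (Submodule.Quotient.mk_eq_zero _).2 h1
  simpa [f4] using h2

/-- The class of a mode of `h_x(-1)h_y(-1)𝟏` on a two letter word, contraction part. -/
def cpart (x y z w : Fin ℓ) (e i j : ℕ) : V ⧸ OV S :=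
  (if y = z then (i : ℂ) else 0) • g2 S x (i + e) w j
    + (if y = w then (j : ℂ) else 0) • g2 S x (j + e) z i
    + (if x = z then (i : ℂ) else 0) • g2 S y (i + e) w j
    + (if x = w then (j : ℂ) else 0) • g2 S y (j + e) z i

theorem q_mode3 (x y z w : Fin ℓ) (i j : ℕ) (hi : 1 ≤ i) (hj : 1 ≤ j) :
    (OV S).mkQ (S.A.Y (SV S.A S.hgen x y 1 1) (-2) (wd2 S.A S.hgen z i w j))
      = f4 S x 1 y 2 z i w j + f4 S x 2 y 1 z i w j + cpart S x y z w 3 i j := by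
  have h1 := mode_quad_wd2 S.heis x y z w 3 i j hi hj
  norm_num [Finset.sum_range_succ, -ite_smul, -zero_smul] at h1
  rw [h1]
  simp only [map_add, map_smul, f4, cpart, g2]

theorem q_mode2 (x y z w : Fin ℓ) (i j : ℕ) (hi : 1 ≤ i) (hj : 1 ≤ j) :
    (OV S).mkQ (S.A.Y (SV S.A S.hgen x y 1 1) (-1) (wd2 S.A S.hgen z i w j))
      = f4 S x 1 y 1 z i w j + cpart S x y z w 2 i j := by
  have h1 := mode_quad_wd2 S.heis x y z w 2 i j hi hj
  norm_num [Finset.sum_range_succ, -ite_smul, -zero_smul] at h1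
  rw [h1]
  simp only [map_add, map_smul, f4, cpart, g2]

theorem q_mode1 (x y z w : Fin ℓ) (i j : ℕ) (hi : 1 ≤ i) (hj : 1 ≤ j) :
    (OV S).mkQ (S.A.Y (SV S.A S.hgen x y 1 1) 0 (wd2 S.A S.hgen z i w j))
      = cpart S x y z w 1 i j := by
  have h1 := mode_quad_wd2 S.heis x y z w 1 i j hi hj
  norm_num [-ite_smul, -zero_smul] at h1
  rw [h1]
  simp only [map_add, map_smul, cpart, g2, add_zero]

theorem q_mode0 (x y z w : Fin ℓ) (i j : ℕ) (hi : 1 ≤ i) (hj : 1 ≤ j) :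
    (OV S).mkQ (S.A.Y (SV S.A S.hgen x y 1 1) 1 (wd2 S.A S.hgen z i w j))
      = cpart S x y z w 0 i j := by
  have h1 := mode_quad_wd2 S.heis x y z w 0 i j hi hj
  norm_num [-ite_smul, -zero_smul] at h1
  rw [h1]
  simp only [map_add, map_smul, cpart, g2, add_zero]

theorem relC (x y z w : Fin ℓ) (i j : ℕ) (hi : 1 ≤ i) (hj : 1 ≤ j) :
    f4 S x 1 y 2 z i w j + f4 S x 2 y 1 z i w j + (2 : ℂ) • f4 S x 1 y 1 z i w j
      + cpart S x y z w 3 i j + (2 : ℂ) • cpart S x y z w 2 i j + cpart S x y z w 1 i j = 0 := by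
  have h1 := C_mem S (theta_wd2 S.thetaAut x y 1 1) (wt_wd2 S.heis x y 1 1)
    (theta_wd2 S.thetaAut z w i j)
  have h2 := (Submodule.Quotient.mk_eq_zero _).2 h1
  have h3 : (OV S).mkQ (S.A.Y (SV S.A S.hgen x y 1 1) (-2) (wd2 S.A S.hgen z i w j))
    + (2 : ℂ) • (OV S).mkQ (S.A.Y (SV S.A S.hgen x y 1 1) (-1) (wd2 S.A S.hgen z i w j))
    + (OV S).mkQ (S.A.Y (SV S.A S.hgen x y 1 1) 0 (wd2 S.A S.hgen z i w j)) = 0 := h2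
  rw [q_mode3 S x y z w i j hi hj, q_mode2 S x y z w i j hi hj, q_mode1 S x y z w i j hi hj] at h3
  rw [← h3]
  module

theorem g2_swap (x : Fin ℓ) (i : ℕ) (y : Fin ℓ) (j : ℕ) : g2 S x i y j = g2 S y j x i := by
  unfold g2
  rw [wd2_swap S.heis]

theorem f4_swap12 (x : Fin ℓ) (i : ℕ) (y : Fin ℓ) (j : ℕ) (z : Fin ℓ) (k : ℕ) (w : Fin ℓ)
    (l : ℕ) : f4 S x i y j z k w l = f4 S y j x i z k w l := by
  unfold f4
  rw [wd4_swap12 S.heis]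

theorem f4_swap23 (x : Fin ℓ) (i : ℕ) (y : Fin ℓ) (j : ℕ) (z : Fin ℓ) (k : ℕ) (w : Fin ℓ)
    (l : ℕ) : f4 S x i y j z k w l = f4 S x i z k y j w l := by
  unfold f4
  rw [wd4_swap23 S.heis]

theorem f4_swap34 (x : Fin ℓ) (i : ℕ) (y : Fin ℓ) (j : ℕ) (z : Fin ℓ) (k : ℕ) (w : Fin ℓ)
    (l : ℕ) : f4 S x i y j z k w l = f4 S x i y j w l z k := by
  unfold f4
  rw [wd4_swap34 S.heis]

end relations


/-! ### Linear algebra consequences of the relations -/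

section certificates

variable {Q : Type} [AddCommGroup Q] [Module ℂ Q] {f : ℕ → ℕ → ℕ → ℕ → Q} {g : ℕ → ℕ → Q}

/-- The combination defining `E^u`. -/
def euC (T : ℕ → Q) : Q :=
  (5 : ℂ) • T 2 + (25 : ℂ) • T 3 + (36 : ℂ) • T 4 + (16 : ℂ) • T 5

/-- The combination defining `E^t`. -/
def etC (T : ℕ → Q) : Q :=
  (-16 : ℂ) • ((3 : ℂ) • T 2 + (14 : ℂ) • T 3 + (19 : ℂ) • T 4 + (8 : ℂ) • T 5)

/-- Relations among words `a a b c`, with `a`, `b`, `c` distinct. -/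
structure RelA (f : ℕ → ℕ → ℕ → ℕ → Q) (g : ℕ → ℕ → Q) : Prop where
  symm12 : ∀ i j k l, f i j k l = f j i k l
  D2 : ∀ i j : ℕ, (i : ℂ) • g (i + 1) j + (j : ℂ) • g i (j + 1) + ((i : ℂ) + (j : ℂ)) • g i j = 0
  D4 : ∀ i j k l : ℕ, (i : ℂ) • f (i + 1) j k l + (j : ℂ) • f i (j + 1) k l
    + (k : ℂ) • f i j (k + 1) l + (l : ℂ) • f i j k (l + 1)
    + ((i : ℂ) + (j : ℂ) + (k : ℂ) + (l : ℂ)) • f i j k l = 0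
  C1 : ∀ i j : ℕ, f 1 2 (i + 1) (j + 1) + f 2 1 (i + 1) (j + 1)
    + (2 : ℂ) • f 1 1 (i + 1) (j + 1) = 0
  C2 : ∀ i j : ℕ, f 1 (i + 1) 2 (j + 1) + f 2 (i + 1) 1 (j + 1)
    + (2 : ℂ) • f 1 (i + 1) 1 (j + 1)
    + ((i : ℂ) + 1) • (g (i + 4) (j + 1) + (2 : ℂ) • g (i + 3) (j + 1) + g (i + 2) (j + 1)) = 0
  C3 : ∀ i j : ℕ, f 1 (i + 1) (j + 1) 2 + f 2 (i + 1) (j + 1) 1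
    + (2 : ℂ) • f 1 (i + 1) (j + 1) 1
    + ((i : ℂ) + 1) • (g (j + 1) (i + 4) + (2 : ℂ) • g (j + 1) (i + 3) + g (j + 1) (i + 2)) = 0
  C4 : ∀ i j : ℕ, f (i + 1) (j + 1) 1 2 + f (i + 1) (j + 1) 2 1
    + (2 : ℂ) • f (i + 1) (j + 1) 1 1 = 0

/-- Relations among words `b b b c`, with `b`, `c` distinct. -/
structure RelB (f : ℕ → ℕ → ℕ → ℕ → Q) (g : ℕ → ℕ → Q) : Prop where
  symm12 : ∀ i j k l, f i j k l = f j i k l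
  symm23 : ∀ i j k l, f i j k l = f i k j l
  D2 : ∀ i j : ℕ, (i : ℂ) • g (i + 1) j + (j : ℂ) • g i (j + 1) + ((i : ℂ) + (j : ℂ)) • g i j = 0
  D4 : ∀ i j k l : ℕ, (i : ℂ) • f (i + 1) j k l + (j : ℂ) • f i (j + 1) k l
    + (k : ℂ) • f i j (k + 1) l + (l : ℂ) • f i j k (l + 1)
    + ((i : ℂ) + (j : ℂ) + (k : ℂ) + (l : ℂ)) • f i j k l = 0
  C1 : ∀ i j : ℕ, f 1 2 (i + 1) (j + 1) + f 2 1 (i + 1) (j + 1)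
    + (2 : ℂ) • f 1 1 (i + 1) (j + 1)
    + (2 * ((i : ℂ) + 1)) • (g (i + 4) (j + 1) + (2 : ℂ) • g (i + 3) (j + 1)
      + g (i + 2) (j + 1)) = 0
  C2 : ∀ i j : ℕ, f 1 (i + 1) (j + 1) 2 + f 2 (i + 1) (j + 1) 1
    + (2 : ℂ) • f 1 (i + 1) (j + 1) 1
    + ((i : ℂ) + 1) • (g (j + 1) (i + 4) + (2 : ℂ) • g (j + 1) (i + 3) + g (j + 1) (i + 2))
    + ((j : ℂ) + 1) • (g (i + 1) (j + 4) + (2 : ℂ) • g (i + 1) (j + 3) + g (i + 1) (j + 2)) = 0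

theorem RelB.rel6 (R : RelB f g) :
    g 1 6 + (3 : ℂ) • g 1 5 + (51 / 16 : ℂ) • g 1 4 + (11 / 8 : ℂ) • g 1 3
      + (3 / 16 : ℂ) • g 1 2 = 0 := by
  linear_combination
    (norm := (simp only [R.symm12, R.symm23,  Nat.reduceAdd, Nat.cast_zero, Nat.cast_one, Nat.cast_ofNat,
      euC, etC]; module))
    (-1/16 : ℂ) • R.C1 2 0 + (-1/32 : ℂ) • R.C2 1 1 + (1/32 : ℂ) • R.D4 1 2 2 1
    + (-1/16 : ℂ) • R.C2 0 1 + (1/5 : ℂ) • R.D2 1 5 + (11/32 : ℂ) • R.D2 1 3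
    + (1/16 : ℂ) • R.D4 1 1 2 1 + (-3/32 : ℂ) • R.C1 1 0 + (27/160 : ℂ) • R.D2 4 1
    + (-3/160 : ℂ) • R.D2 3 2 + (-3/160 : ℂ) • R.D2 2 3 + (3/32 : ℂ) • R.D2 3 1
    + (1/16 : ℂ) • R.D2 1 2 + (3/40 : ℂ) • R.D2 5 1 + (-3/160 : ℂ) • R.D2 4 2
    + (1/80 : ℂ) • R.D2 3 3 + (-3/160 : ℂ) • R.D2 2 4 + (77/160 : ℂ) • R.D2 1 4

theorem RelA.u (R : RelA f g) (h6 : g 1 6 + (3 : ℂ) • g 1 5 + (51 / 16 : ℂ) • g 1 4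
    + (11 / 8 : ℂ) • g 1 3 + (3 / 16 : ℂ) • g 1 2 = 0) :
    euC (fun m => (1 / 2 : ℂ) • f 1 1 1 m)
      = (0 : ℂ) • euC (fun m => g 1 m) := by
  linear_combination
    (norm := (simp only [R.symm12,  Nat.reduceAdd, Nat.cast_zero, Nat.cast_one, Nat.cast_ofNat,
      euC, etC]; module))
    (2 : ℂ) • R.D4 1 1 1 4 + (25/4 : ℂ) • R.C3 2 1 + (5/3 : ℂ) • R.D4 2 2 1 2
    + (-71/6 : ℂ) • R.D2 1 5 + (-5/2 : ℂ) • R.D4 2 2 1 1 + (-5/6 : ℂ) • R.C1 2 1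
    + (7/4 : ℂ) • R.D2 2 3 + (199/24 : ℂ) • R.D2 3 2 + (65/6 : ℂ) • R.C3 2 0
    + (-85/12 : ℂ) • R.D4 1 2 2 1 + (-2 : ℂ) • R.C2 0 3 + (-25/4 : ℂ) • R.C2 1 0
    + (5/3 : ℂ) • R.C2 2 0 + (80/3 : ℂ) • h6 + (-5/4 : ℂ) • R.D4 2 2 2 1
    + (875/24 : ℂ) • R.C1 0 1 + (13/4 : ℂ) • R.D2 5 2 + (-55/6 : ℂ) • R.D4 1 1 2 1
    + (50 : ℂ) • R.D4 1 1 1 1 + (-1 : ℂ) • R.C1 0 3 + (25/8 : ℂ) • R.D2 3 1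
    + (-25/2 : ℂ) • R.D4 1 2 1 1 + (5/2 : ℂ) • R.C3 1 2 + (-5/12 : ℂ) • R.D4 1 2 2 2
    + (5/8 : ℂ) • R.D2 3 4 + (505/24 : ℂ) • R.C1 1 1 + (-7/12 : ℂ) • R.D2 2 4
    + (377/24 : ℂ) • R.D2 4 2 + (-15/4 : ℂ) • R.D2 2 5 + (-75 : ℂ) • R.C4 0 0
    + (-35/6 : ℂ) • R.C3 0 1 + (165/4 : ℂ) • R.C1 1 0 + (-65/12 : ℂ) • R.C2 2 1
    + (20/3 : ℂ) • R.D2 1 2 + (135/8 : ℂ) • R.C4 1 1 + (-5/4 : ℂ) • R.C4 1 2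
    + (55/6 : ℂ) • R.C3 0 2 + (25/12 : ℂ) • R.C1 1 2 + (-15/4 : ℂ) • R.D4 1 1 1 2
    + (-5/6 : ℂ) • R.C2 0 1 + (35/24 : ℂ) • R.C3 1 1 + (-15/4 : ℂ) • R.D4 1 1 2 2
    + (17/8 : ℂ) • R.D2 4 1 + (-10/3 : ℂ) • R.C2 1 2 + (-37/2 : ℂ) • R.D2 1 4
    + (-49/8 : ℂ) • R.D2 3 3 + (1/24 : ℂ) • R.D2 4 3 + (-25 : ℂ) • R.C3 0 0
    + (-625/24 : ℂ) • R.C2 1 1 + (-1 : ℂ) • R.D2 5 1 + (10/3 : ℂ) • R.D4 1 1 1 3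

theorem RelA.t (R : RelA f g) (h6 : g 1 6 + (3 : ℂ) • g 1 5 + (51 / 16 : ℂ) • g 1 4
    + (11 / 8 : ℂ) • g 1 3 + (3 / 16 : ℂ) • g 1 2 = 0) :
    etC (fun m => (1 / 2 : ℂ) • f 1 1 1 m)
      = (1 / 16 : ℂ) • etC (fun m => g 1 m) := by
  linear_combination
    (norm := (simp only [R.symm12,  Nat.reduceAdd, Nat.cast_zero, Nat.cast_one, Nat.cast_ofNat,
      euC, etC]; module))
    (-16 : ℂ) • R.D4 1 1 1 4 + (-166/3 : ℂ) • R.C3 2 1 + (-44/3 : ℂ) • R.D4 2 2 1 2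
    + (100 : ℂ) • R.D2 1 5 + (70/3 : ℂ) • R.D4 2 2 1 1 + (8 : ℂ) • R.C1 2 1
    + (-34/5 : ℂ) • R.D2 2 3 + (-393/5 : ℂ) • R.D2 3 2 + (-292/3 : ℂ) • R.C3 2 0
    + (190/3 : ℂ) • R.D4 1 2 2 1 + (16 : ℂ) • R.C2 0 3 + (134/3 : ℂ) • R.C2 1 0
    + (-16 : ℂ) • R.C2 2 0 + (-208 : ℂ) • h6 + (34/3 : ℂ) • R.D4 2 2 2 1 + (-327 : ℂ) • R.C1 0 1
    + (-146/5 : ℂ) • R.D2 5 2 + (244/3 : ℂ) • R.D4 1 1 2 1 + (-430 : ℂ) • R.D4 1 1 1 1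
    + (8 : ℂ) • R.C1 0 3 + (-67/3 : ℂ) • R.D2 3 1 + (340/3 : ℂ) • R.D4 1 2 1 1
    + (-68/3 : ℂ) • R.C3 1 2 + (10/3 : ℂ) • R.D4 1 2 2 2 + (-79/15 : ℂ) • R.D2 3 4
    + (-545/3 : ℂ) • R.C1 1 1 + (42/5 : ℂ) • R.D2 2 4 + (-2077/15 : ℂ) • R.D2 4 2
    + (166/5 : ℂ) • R.D2 2 5 + (656 : ℂ) • R.C4 0 0 + (34 : ℂ) • R.C3 0 1
    + (-1051/3 : ℂ) • R.C1 1 0 + (146/3 : ℂ) • R.C2 2 1 + (-54 : ℂ) • R.D2 1 2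
    + (-149 : ℂ) • R.C4 1 1 + (10 : ℂ) • R.C4 1 2 + (-244/3 : ℂ) • R.C3 0 2
    + (-18 : ℂ) • R.C1 1 2 + (32 : ℂ) • R.D4 1 1 1 2 + (20 : ℂ) • R.C2 0 1
    + (-17 : ℂ) • R.C3 1 1 + (98/3 : ℂ) • R.D4 1 1 2 2 + (-191/15 : ℂ) • R.D2 4 1
    + (88/3 : ℂ) • R.C2 1 2 + (154 : ℂ) • R.D2 1 4 + (2401/45 : ℂ) • R.D2 3 3
    + (-1/15 : ℂ) • R.D2 4 3 + (204 : ℂ) • R.C3 0 0 + (685/3 : ℂ) • R.C2 1 1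
    + (48/5 : ℂ) • R.D2 5 1 + (-88/3 : ℂ) • R.D4 1 1 1 3

theorem RelB.ul (R : RelB f g) (h6 : g 1 6 + (3 : ℂ) • g 1 5 + (51 / 16 : ℂ) • g 1 4
    + (11 / 8 : ℂ) • g 1 3 + (3 / 16 : ℂ) • g 1 2 = 0) :
    euC (fun m => (1 / 2 : ℂ) • f 1 1 1 m + g 3 m + (2 : ℂ) • g 2 m + g 1 m)
      = (1 : ℂ) • euC (fun m => g 1 m) := by
  linear_combination
    (norm := (simp only [R.symm12, R.symm23,  Nat.reduceAdd, Nat.cast_zero, Nat.cast_one, Nat.cast_ofNat,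
      euC, etC]; module))
    (15/4 : ℂ) • R.C2 1 2 + (25 : ℂ) • R.D4 1 1 2 1 + (5/8 : ℂ) • R.D4 1 2 2 2
    + (-5/8 : ℂ) • R.C1 1 2 + (35/8 : ℂ) • R.D4 1 2 2 1 + (15/4 : ℂ) • R.D2 5 2 + (220 : ℂ) • h6
    + (-205/8 : ℂ) • R.C1 0 1 + (13/4 : ℂ) • R.D2 3 4 + (190/3 : ℂ) • R.D2 1 3
    + (-29 : ℂ) • R.D2 1 5 + (-367/8 : ℂ) • R.D2 1 4 + (65/24 : ℂ) • R.D2 3 3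
    + (2 : ℂ) • R.D4 1 1 1 4 + (217/16 : ℂ) • R.D2 2 4 + (-20 : ℂ) • R.C1 1 1
    + (-1375/16 : ℂ) • R.C1 0 0 + (-5/4 : ℂ) • R.D2 4 3 + (125/8 : ℂ) • R.D4 1 1 2 2
    + (1815/16 : ℂ) • R.D4 1 1 1 1 + (-25/8 : ℂ) • R.C1 2 1 + (-2255/16 : ℂ) • R.C2 0 0
    + (215/6 : ℂ) • R.D2 2 3 + (10/3 : ℂ) • R.D4 1 1 1 3 + (365/16 : ℂ) • R.D2 4 2
    + (-20 : ℂ) • R.C1 0 2 + (-9/4 : ℂ) • R.D2 2 5 + (1925/24 : ℂ) • R.D2 1 2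
    + (65/4 : ℂ) • R.D4 1 1 1 2 + (-25 : ℂ) • R.C2 0 2 + (745/24 : ℂ) • R.D2 3 2
    + (1375/24 : ℂ) • R.D2 2 1 + (-5/8 : ℂ) • R.D4 2 2 2 1 + (1375/24 : ℂ) • R.D2 3 1
    + (-305/4 : ℂ) • R.C2 0 1 + (-3 : ℂ) • R.C1 0 3

theorem RelB.ur (R : RelB f g) (h6 : g 1 6 + (3 : ℂ) • g 1 5 + (51 / 16 : ℂ) • g 1 4
    + (11 / 8 : ℂ) • g 1 3 + (3 / 16 : ℂ) • g 1 2 = 0) :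
    euC (fun m => (1 / 2 : ℂ) • f 1 1 1 m + g 3 m + g 2 m)
      = (0 : ℂ) • euC (fun m => g 1 m) := by
  linear_combination
    (norm := (simp only [R.symm12, R.symm23,  Nat.reduceAdd, Nat.cast_zero, Nat.cast_one, Nat.cast_ofNat,
      euC, etC]; module))
    (15/4 : ℂ) • R.C2 1 2 + (25 : ℂ) • R.D4 1 1 2 1 + (5/8 : ℂ) • R.D4 1 2 2 2
    + (-5/8 : ℂ) • R.C1 1 2 + (35/8 : ℂ) • R.D4 1 2 2 1 + (15/4 : ℂ) • R.D2 5 2 + (300 : ℂ) • h6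
    + (-205/8 : ℂ) • R.C1 0 1 + (13/4 : ℂ) • R.D2 3 4 + (115/3 : ℂ) • R.D2 1 3
    + (-45 : ℂ) • R.D2 1 5 + (-655/8 : ℂ) • R.D2 1 4 + (65/24 : ℂ) • R.D2 3 3
    + (2 : ℂ) • R.D4 1 1 1 4 + (217/16 : ℂ) • R.D2 2 4 + (-20 : ℂ) • R.C1 1 1
    + (-1375/16 : ℂ) • R.C1 0 0 + (-5/4 : ℂ) • R.D2 4 3 + (125/8 : ℂ) • R.D4 1 1 2 2
    + (1815/16 : ℂ) • R.D4 1 1 1 1 + (-25/8 : ℂ) • R.C1 2 1 + (-2255/16 : ℂ) • R.C2 0 0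
    + (215/6 : ℂ) • R.D2 2 3 + (10/3 : ℂ) • R.D4 1 1 1 3 + (365/16 : ℂ) • R.D2 4 2
    + (-20 : ℂ) • R.C1 0 2 + (-9/4 : ℂ) • R.D2 2 5 + (1805/24 : ℂ) • R.D2 1 2
    + (65/4 : ℂ) • R.D4 1 1 1 2 + (-25 : ℂ) • R.C2 0 2 + (745/24 : ℂ) • R.D2 3 2
    + (1375/24 : ℂ) • R.D2 2 1 + (-5/8 : ℂ) • R.D4 2 2 2 1 + (1375/24 : ℂ) • R.D2 3 1
    + (-305/4 : ℂ) • R.C2 0 1 + (-3 : ℂ) • R.C1 0 3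

theorem RelB.tl (R : RelB f g) (h6 : g 1 6 + (3 : ℂ) • g 1 5 + (51 / 16 : ℂ) • g 1 4
    + (11 / 8 : ℂ) • g 1 3 + (3 / 16 : ℂ) • g 1 2 = 0) :
    etC (fun m => (1 / 2 : ℂ) • f 1 1 1 m + g 3 m + (2 : ℂ) • g 2 m + g 1 m)
      = (9 / 16 : ℂ) • etC (fun m => g 1 m) := by
  linear_combination
    (norm := (simp only [R.symm12, R.symm23,  Nat.reduceAdd, Nat.cast_zero, Nat.cast_one, Nat.cast_ofNat,
      euC, etC]; module))
    (-30 : ℂ) • R.C2 1 2 + (-200 : ℂ) • R.D4 1 1 2 1 + (-5 : ℂ) • R.D4 1 2 2 2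
    + (5 : ℂ) • R.C1 1 2 + (-35 : ℂ) • R.D4 1 2 2 1 + (-30 : ℂ) • R.D2 5 2 + (-1840 : ℂ) • h6
    + (208 : ℂ) • R.C1 0 1 + (-26 : ℂ) • R.D2 3 4 + (-1538/3 : ℂ) • R.D2 1 3
    + (248 : ℂ) • R.D2 1 5 + (389 : ℂ) • R.D2 1 4 + (-73/3 : ℂ) • R.D2 3 3
    + (-16 : ℂ) • R.D4 1 1 1 4 + (-225/2 : ℂ) • R.D2 2 4 + (160 : ℂ) • R.C1 1 1
    + (1405/2 : ℂ) • R.C1 0 0 + (10 : ℂ) • R.D2 4 3 + (-125 : ℂ) • R.D4 1 1 2 2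
    + (-1845/2 : ℂ) • R.D4 1 1 1 1 + (25 : ℂ) • R.C1 2 1 + (2285/2 : ℂ) • R.C2 0 0
    + (-890/3 : ℂ) • R.D2 2 3 + (-88/3 : ℂ) • R.D4 1 1 1 3 + (-365/2 : ℂ) • R.D2 4 2
    + (164 : ℂ) • R.C1 0 2 + (18 : ℂ) • R.D2 2 5 + (-1961/3 : ℂ) • R.D2 1 2
    + (-132 : ℂ) • R.D4 1 1 1 2 + (200 : ℂ) • R.C2 0 2 + (-751/3 : ℂ) • R.D2 3 2
    + (-1405/3 : ℂ) • R.D2 2 1 + (5 : ℂ) • R.D4 2 2 2 1 + (-1405/3 : ℂ) • R.D2 3 1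
    + (610 : ℂ) • R.C2 0 1 + (24 : ℂ) • R.C1 0 3

theorem RelB.tr (R : RelB f g) (h6 : g 1 6 + (3 : ℂ) • g 1 5 + (51 / 16 : ℂ) • g 1 4
    + (11 / 8 : ℂ) • g 1 3 + (3 / 16 : ℂ) • g 1 2 = 0) :
    etC (fun m => (1 / 2 : ℂ) • f 1 1 1 m + g 3 m + g 2 m)
      = (1 / 16 : ℂ) • etC (fun m => g 1 m) := by
  linear_combination
    (norm := (simp only [R.symm12, R.symm23,  Nat.reduceAdd, Nat.cast_zero, Nat.cast_one, Nat.cast_ofNat,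
      euC, etC]; module))
    (-30 : ℂ) • R.C2 1 2 + (-200 : ℂ) • R.D4 1 1 2 1 + (-5 : ℂ) • R.D4 1 2 2 2
    + (5 : ℂ) • R.C1 1 2 + (-35 : ℂ) • R.D4 1 2 2 1 + (-30 : ℂ) • R.D2 5 2 + (-2480 : ℂ) • h6
    + (208 : ℂ) • R.C1 0 1 + (-26 : ℂ) • R.D2 3 4 + (-866/3 : ℂ) • R.D2 1 3
    + (376 : ℂ) • R.D2 1 5 + (693 : ℂ) • R.D2 1 4 + (-73/3 : ℂ) • R.D2 3 3
    + (-16 : ℂ) • R.D4 1 1 1 4 + (-225/2 : ℂ) • R.D2 2 4 + (160 : ℂ) • R.C1 1 1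
    + (1405/2 : ℂ) • R.C1 0 0 + (10 : ℂ) • R.D2 4 3 + (-125 : ℂ) • R.D4 1 1 2 2
    + (-1845/2 : ℂ) • R.D4 1 1 1 1 + (25 : ℂ) • R.C1 2 1 + (2285/2 : ℂ) • R.C2 0 0
    + (-890/3 : ℂ) • R.D2 2 3 + (-88/3 : ℂ) • R.D4 1 1 1 3 + (-365/2 : ℂ) • R.D2 4 2
    + (164 : ℂ) • R.C1 0 2 + (18 : ℂ) • R.D2 2 5 + (-1817/3 : ℂ) • R.D2 1 2
    + (-132 : ℂ) • R.D4 1 1 1 2 + (200 : ℂ) • R.C2 0 2 + (-751/3 : ℂ) • R.D2 3 2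
    + (-1405/3 : ℂ) • R.D2 2 1 + (5 : ℂ) • R.D4 2 2 2 1 + (-1405/3 : ℂ) • R.D2 3 1
    + (610 : ℂ) • R.C2 0 1 + (24 : ℂ) • R.C1 0 3

theorem RelB.ul2 (R : RelB f g) (h6 : g 6 1 + (3 : ℂ) • g 5 1 + (51 / 16 : ℂ) • g 4 1
    + (11 / 8 : ℂ) • g 3 1 + (3 / 16 : ℂ) • g 2 1 = 0) :
    euC (fun m => (1 / 2 : ℂ) • f 1 1 m 1 + (m : ℂ) • (g (m + 2) 1
      + (2 : ℂ) • g (m + 1) 1 + g m 1))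
      = (0 : ℂ) • euC (fun m => g m 1) := by
  linear_combination
    (norm := (simp only [R.symm12, R.symm23,  Nat.reduceAdd, Nat.cast_zero, Nat.cast_one, Nat.cast_ofNat,
      euC, etC]; module))
    (-15/4 : ℂ) • R.C2 0 3 + (-7/12 : ℂ) • R.C1 2 1 + (-1/8 : ℂ) • R.C1 3 0
    + (19/12 : ℂ) • R.C1 1 0 + (29/2 : ℂ) • R.C1 0 0 + (140 : ℂ) • h6 + (7/8 : ℂ) • R.C1 0 3
    + (109/8 : ℂ) • R.C1 0 1 + (23/4 : ℂ) • R.C1 0 2 + (7/12 : ℂ) • R.C1 1 2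
    + (41/12 : ℂ) • R.C1 1 1 + (-47/12 : ℂ) • R.C1 2 0 + (7/12 : ℂ) • R.D4 1 1 3 2
    + (2 : ℂ) • R.D4 1 1 4 1 + (-19/12 : ℂ) • R.D4 1 1 2 1 + (-41/12 : ℂ) • R.D4 1 1 2 2
    + (-7/12 : ℂ) • R.D4 1 1 2 3 + (47/12 : ℂ) • R.D4 1 1 3 1 + (1/4 : ℂ) • R.D2 2 4
    + (-181/12 : ℂ) • R.D2 2 1 + (-73/24 : ℂ) • R.D2 2 2 + (27/2 : ℂ) • R.D2 6 1
    + (19 : ℂ) • R.D2 5 1 + (-23/12 : ℂ) • R.D2 3 3 + (-2 : ℂ) • R.D2 5 2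
    + (-1/2 : ℂ) • R.D2 2 5 + (-35/12 : ℂ) • R.D2 4 2 + (-29/4 : ℂ) • R.D4 1 1 1 1
    + (-395/12 : ℂ) • R.D2 3 1 + (-13/12 : ℂ) • R.D2 2 3 + (-35/6 : ℂ) • R.D2 3 2
    + (5/12 : ℂ) • R.D2 4 3 + (-37/3 : ℂ) • R.D2 4 1 + (5/2 : ℂ) • R.D2 1 5
    + (-4 : ℂ) • R.D4 1 1 1 2 + (1/4 : ℂ) • R.D2 3 4 + (5/2 : ℂ) • R.D2 1 6
    + (-7/12 : ℂ) • R.D4 1 1 1 3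

theorem RelB.ur2 (R : RelB f g) (h6 : g 6 1 + (3 : ℂ) • g 5 1 + (51 / 16 : ℂ) • g 4 1
    + (11 / 8 : ℂ) • g 3 1 + (3 / 16 : ℂ) • g 2 1 = 0) :
    euC (fun m => (1 / 2 : ℂ) • f 1 1 m 1 + (m : ℂ) • (g (m + 2) 1 + g (m + 1) 1))
      = (1 : ℂ) • euC (fun m => g m 1) := by
  linear_combination
    (norm := (simp only [R.symm12, R.symm23,  Nat.reduceAdd, Nat.cast_zero, Nat.cast_one, Nat.cast_ofNat,
      euC, etC]; module))
    (-15/4 : ℂ) • R.C2 0 3 + (-7/12 : ℂ) • R.C1 2 1 + (-1/8 : ℂ) • R.C1 3 0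
    + (19/12 : ℂ) • R.C1 1 0 + (29/2 : ℂ) • R.C1 0 0 + (60 : ℂ) • h6 + (7/8 : ℂ) • R.C1 0 3
    + (109/8 : ℂ) • R.C1 0 1 + (23/4 : ℂ) • R.C1 0 2 + (7/12 : ℂ) • R.C1 1 2
    + (41/12 : ℂ) • R.C1 1 1 + (-47/12 : ℂ) • R.C1 2 0 + (7/12 : ℂ) • R.D4 1 1 3 2
    + (2 : ℂ) • R.D4 1 1 4 1 + (-19/12 : ℂ) • R.D4 1 1 2 1 + (-41/12 : ℂ) • R.D4 1 1 2 2
    + (-7/12 : ℂ) • R.D4 1 1 2 3 + (47/12 : ℂ) • R.D4 1 1 3 1 + (1/4 : ℂ) • R.D2 2 4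
    + (-181/12 : ℂ) • R.D2 2 1 + (-73/24 : ℂ) • R.D2 2 2 + (27/2 : ℂ) • R.D2 6 1
    + (19 : ℂ) • R.D2 5 1 + (-23/12 : ℂ) • R.D2 3 3 + (-2 : ℂ) • R.D2 5 2
    + (-1/2 : ℂ) • R.D2 2 5 + (-35/12 : ℂ) • R.D2 4 2 + (-29/4 : ℂ) • R.D4 1 1 1 1
    + (-395/12 : ℂ) • R.D2 3 1 + (-13/12 : ℂ) • R.D2 2 3 + (-35/6 : ℂ) • R.D2 3 2
    + (5/12 : ℂ) • R.D2 4 3 + (-37/3 : ℂ) • R.D2 4 1 + (5/2 : ℂ) • R.D2 1 5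
    + (-4 : ℂ) • R.D4 1 1 1 2 + (1/4 : ℂ) • R.D2 3 4 + (5/2 : ℂ) • R.D2 1 6
    + (-7/12 : ℂ) • R.D4 1 1 1 3

theorem RelB.tl2 (R : RelB f g) (h6 : g 6 1 + (3 : ℂ) • g 5 1 + (51 / 16 : ℂ) • g 4 1
    + (11 / 8 : ℂ) • g 3 1 + (3 / 16 : ℂ) • g 2 1 = 0) :
    etC (fun m => (1 / 2 : ℂ) • f 1 1 m 1 + (m : ℂ) • (g (m + 2) 1
      + (2 : ℂ) • g (m + 1) 1 + g m 1))
      = (1 / 16 : ℂ) • etC (fun m => g m 1) := by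
  linear_combination
    (norm := (simp only [R.symm12, R.symm23,  Nat.reduceAdd, Nat.cast_zero, Nat.cast_one, Nat.cast_ofNat,
      euC, etC]; module))
    (30 : ℂ) • R.C2 0 3 + (14/3 : ℂ) • R.C1 2 1 + (1 : ℂ) • R.C1 3 0 + (-12 : ℂ) • R.C1 1 0
    + (-120 : ℂ) • R.C1 0 0 + (-1200 : ℂ) • h6 + (-7 : ℂ) • R.C1 0 3 + (-340/3 : ℂ) • R.C1 0 1
    + (-142/3 : ℂ) • R.C1 0 2 + (-14/3 : ℂ) • R.C1 1 2 + (-86/3 : ℂ) • R.C1 1 1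
    + (34 : ℂ) • R.C1 2 0 + (-14/3 : ℂ) • R.D4 1 1 3 2 + (-16 : ℂ) • R.D4 1 1 4 1
    + (12 : ℂ) • R.D4 1 1 2 1 + (86/3 : ℂ) • R.D4 1 1 2 2 + (14/3 : ℂ) • R.D4 1 1 2 3
    + (-34 : ℂ) • R.D4 1 1 3 1 + (-2 : ℂ) • R.D2 2 4 + (124 : ℂ) • R.D2 2 1
    + (77/3 : ℂ) • R.D2 2 2 + (-108 : ℂ) • R.D2 6 1 + (-152 : ℂ) • R.D2 5 1
    + (46/3 : ℂ) • R.D2 3 3 + (16 : ℂ) • R.D2 5 2 + (4 : ℂ) • R.D2 2 5 + (74/3 : ℂ) • R.D2 4 2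
    + (60 : ℂ) • R.D4 1 1 1 1 + (270 : ℂ) • R.D2 3 1 + (26/3 : ℂ) • R.D2 2 3
    + (148/3 : ℂ) • R.D2 3 2 + (-10/3 : ℂ) • R.D2 4 3 + (102 : ℂ) • R.D2 4 1
    + (-20 : ℂ) • R.D2 1 5 + (100/3 : ℂ) • R.D4 1 1 1 2 + (-2 : ℂ) • R.D2 3 4
    + (-20 : ℂ) • R.D2 1 6 + (14/3 : ℂ) • R.D4 1 1 1 3

theorem RelB.tr2 (R : RelB f g) (h6 : g 6 1 + (3 : ℂ) • g 5 1 + (51 / 16 : ℂ) • g 4 1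
    + (11 / 8 : ℂ) • g 3 1 + (3 / 16 : ℂ) • g 2 1 = 0) :
    etC (fun m => (1 / 2 : ℂ) • f 1 1 m 1 + (m : ℂ) • (g (m + 2) 1 + g (m + 1) 1))
      = (9 / 16 : ℂ) • etC (fun m => g m 1) := by
  linear_combination
    (norm := (simp only [R.symm12, R.symm23,  Nat.reduceAdd, Nat.cast_zero, Nat.cast_one, Nat.cast_ofNat,
      euC, etC]; module))
    (30 : ℂ) • R.C2 0 3 + (14/3 : ℂ) • R.C1 2 1 + (1 : ℂ) • R.C1 3 0 + (-12 : ℂ) • R.C1 1 0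
    + (-120 : ℂ) • R.C1 0 0 + (-560 : ℂ) • h6 + (-7 : ℂ) • R.C1 0 3 + (-340/3 : ℂ) • R.C1 0 1
    + (-142/3 : ℂ) • R.C1 0 2 + (-14/3 : ℂ) • R.C1 1 2 + (-86/3 : ℂ) • R.C1 1 1
    + (34 : ℂ) • R.C1 2 0 + (-14/3 : ℂ) • R.D4 1 1 3 2 + (-16 : ℂ) • R.D4 1 1 4 1
    + (12 : ℂ) • R.D4 1 1 2 1 + (86/3 : ℂ) • R.D4 1 1 2 2 + (14/3 : ℂ) • R.D4 1 1 2 3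
    + (-34 : ℂ) • R.D4 1 1 3 1 + (-2 : ℂ) • R.D2 2 4 + (124 : ℂ) • R.D2 2 1
    + (77/3 : ℂ) • R.D2 2 2 + (-108 : ℂ) • R.D2 6 1 + (-152 : ℂ) • R.D2 5 1
    + (46/3 : ℂ) • R.D2 3 3 + (16 : ℂ) • R.D2 5 2 + (4 : ℂ) • R.D2 2 5 + (74/3 : ℂ) • R.D2 4 2
    + (60 : ℂ) • R.D4 1 1 1 1 + (270 : ℂ) • R.D2 3 1 + (26/3 : ℂ) • R.D2 2 3
    + (148/3 : ℂ) • R.D2 3 2 + (-10/3 : ℂ) • R.D2 4 3 + (102 : ℂ) • R.D2 4 1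
    + (-20 : ℂ) • R.D2 1 5 + (100/3 : ℂ) • R.D4 1 1 1 2 + (-2 : ℂ) • R.D2 3 4
    + (-20 : ℂ) • R.D2 1 6 + (14/3 : ℂ) • R.D4 1 1 1 3

end certificates

/-! ### The products with `ω_a` -/

section final

variable {ℓ : ℕ} {V W : Type} [AddCommGroup V] [Module ℂ V] [AddCommGroup W] [Module ℂ W]
  (S : HeisenbergPlusSetting ℓ V W)

theorem relA_holds (a b c : Fin ℓ) (hab : a ≠ b) (hac : a ≠ c) (hbc : b ≠ c) :
    RelA (fun i j k l => f4 S a i a j b k c l) (fun k l => g2 S b k c l) where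
  symm12 i j k l := f4_swap12 S _ _ _ _ _ _ _ _
  D2 i j := relD2 S b c i j
  D4 i j k l := relD4 S a a b c i j k l
  C1 i j := by
    have h := relC S a a b c (i + 1) (j + 1) (by omega) (by omega)
    simpa [cpart, hab, hac] using h
  C2 i j := by
    have h := relC S a b a c (i + 1) (j + 1) (by omega) (by omega)
    have e : ∀ p q i j, f4 S a p b q a i c j = f4 S a p a i b q c j := fun p q i j =>
      f4_swap23 S _ _ _ _ _ _ _ _
    simp only [e, cpart, hab.symm, hac, hbc, if_true, if_false, zero_smul, zero_add, add_zero,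
      add_assoc, Nat.reduceAdd] at h
    simp only [← h, Nat.cast_add, Nat.cast_one]
    module
  C3 i j := by
    have h := relC S a c a b (i + 1) (j + 1) (by omega) (by omega)
    have e : ∀ p q i j, f4 S a p c q a i b j = f4 S a p a i b j c q := fun p q i j => by
      rw [f4_swap23 S, f4_swap34 S]
    have e2 : ∀ p q, g2 S c p b q = g2 S b q c p := fun p q => g2_swap S _ _ _ _
    simp only [e, e2, cpart, hac.symm, hab, hbc.symm, if_true, if_false, zero_smul, zero_add,
      add_zero, add_assoc, Nat.reduceAdd] at h
    simp only [← h, Nat.cast_add, Nat.cast_one]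
    module
  C4 i j := by
    have h := relC S b c a a (i + 1) (j + 1) (by omega) (by omega)
    have e : ∀ p q i j, f4 S b p c q a i a j = f4 S a i a j b p c q := fun p q i j => by
      rw [f4_swap23 S, f4_swap12 S, f4_swap34 S, f4_swap23 S]
    simpa [e, cpart, hab.symm, hac.symm] using h

theorem relB_holds (b c : Fin ℓ) (hbc : b ≠ c) :
    RelB (fun i j k l => f4 S b i b j b k c l) (fun k l => g2 S b k c l) where
  symm12 i j k l := f4_swap12 S _ _ _ _ _ _ _ _
  symm23 i j k l := f4_swap23 S _ _ _ _ _ _ _ _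
  D2 i j := relD2 S b c i j
  D4 i j k l := relD4 S b b b c i j k l
  C1 i j := by
    have h := relC S b b b c (i + 1) (j + 1) (by omega) (by omega)
    simp only [cpart, hbc, if_true, if_false, zero_smul, zero_add, add_zero,
      add_assoc, Nat.reduceAdd] at h
    simp only [← h, Nat.cast_add, Nat.cast_one]
    module
  C2 i j := by
    have h := relC S b c b b (i + 1) (j + 1) (by omega) (by omega)
    have e : ∀ p q i j, f4 S b p c q b i b j = f4 S b p b i b j c q := fun p q i j => by
      rw [f4_swap23 S, f4_swap34 S]
    have e2 : ∀ p q, g2 S c p b q = g2 S b q c p := fun p q => g2_swap S _ _ _ _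
    simp only [e, e2, cpart, hbc.symm, if_true, if_false, zero_smul, zero_add,
      add_zero, add_assoc, Nat.reduceAdd] at h
    simp only [← h, Nat.cast_add, Nat.cast_one]
    module

/-- The class of `ω_a * S_{bc}(1,m)`. -/
def TL (a b c : Fin ℓ) (m : ℕ) : V ⧸ OV S :=
  (1 / 2 : ℂ) • (f4 S a 1 a 1 b 1 c m + cpart S a a b c 2 1 m
    + (2 : ℂ) • cpart S a a b c 1 1 m + cpart S a a b c 0 1 m)

/-- The class of `S_{bc}(1,m) * ω_a`. -/
def TR (a b c : Fin ℓ) (m : ℕ) : V ⧸ OV S :=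
  (1 / 2 : ℂ) • (f4 S a 1 a 1 b 1 c m + cpart S a a b c 2 1 m + cpart S a a b c 1 1 m)

theorem TL_none {a b c : Fin ℓ} (hab : a ≠ b) (hac : a ≠ c) :
    TL S a b c = fun m => (1 / 2 : ℂ) • f4 S a 1 a 1 b 1 c m := by
  funext m
  simp [TL, cpart, hab, hac]

theorem TR_none {a b c : Fin ℓ} (hab : a ≠ b) (hac : a ≠ c) :
    TR S a b c = fun m => (1 / 2 : ℂ) • f4 S a 1 a 1 b 1 c m := by
  funext m
  simp [TR, cpart, hab, hac]

theorem TL_left {b c : Fin ℓ} (hbc : b ≠ c) :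
    TL S b b c = fun m => (1 / 2 : ℂ) • f4 S b 1 b 1 b 1 c m + g2 S b 3 c m
      + (2 : ℂ) • g2 S b 2 c m + g2 S b 1 c m := by
  funext m
  simp only [TL, cpart, hbc, if_true, if_false, zero_smul, add_zero, Nat.reduceAdd, Nat.cast_one]
  module

theorem TR_left {b c : Fin ℓ} (hbc : b ≠ c) :
    TR S b b c = fun m => (1 / 2 : ℂ) • f4 S b 1 b 1 b 1 c m + g2 S b 3 c m
      + g2 S b 2 c m := by
  funext m
  simp only [TR, cpart, hbc, if_true, if_false, zero_smul, add_zero, Nat.reduceAdd, Nat.cast_one]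
  module

theorem TL_right {b c : Fin ℓ} (hbc : b ≠ c) :
    TL S c b c = fun m => (1 / 2 : ℂ) • f4 S c 1 c 1 c m b 1
      + (m : ℂ) • (g2 S c (m + 2) b 1 + (2 : ℂ) • g2 S c (m + 1) b 1 + g2 S c m b 1) := by
  funext m
  rw [← f4_swap34 S c 1 c 1 b 1 c m]
  simp only [TL, cpart, hbc.symm, if_true, if_false, zero_smul, add_zero, zero_add]
  module

theorem TR_right {b c : Fin ℓ} (hbc : b ≠ c) :
    TR S c b c = fun m => (1 / 2 : ℂ) • f4 S c 1 c 1 c m b 1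
      + (m : ℂ) • (g2 S c (m + 2) b 1 + g2 S c (m + 1) b 1) := by
  funext m
  rw [← f4_swap34 S c 1 c 1 b 1 c m]
  simp only [TR, cpart, hbc.symm, if_true, if_false, zero_smul, add_zero, zero_add]
  module

theorem rel6_holds {b c : Fin ℓ} (hbc : b ≠ c) :
    g2 S b 1 c 6 + (3 : ℂ) • g2 S b 1 c 5 + (51 / 16 : ℂ) • g2 S b 1 c 4
      + (11 / 8 : ℂ) • g2 S b 1 c 3 + (3 / 16 : ℂ) • g2 S b 1 c 2 = 0 :=
  (relB_holds S b c hbc).rel6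

theorem rel6_holds' {b c : Fin ℓ} (hbc : b ≠ c) :
    g2 S c 6 b 1 + (3 : ℂ) • g2 S c 5 b 1 + (51 / 16 : ℂ) • g2 S c 4 b 1
      + (11 / 8 : ℂ) • g2 S c 3 b 1 + (3 / 16 : ℂ) • g2 S c 2 b 1 = 0 := by
  have e2 : ∀ p q, g2 S c p b q = g2 S b q c p := fun p q => g2_swap S _ _ _ _
  simp only [e2]
  exact rel6_holds S hbc

/-- All identities, in the quotient. -/
theorem quot_identities (a b c : Fin ℓ) (hbc : b ≠ c) :
    euC (TL S a b c) = (if a = b then (1 : ℂ) else 0) • euC (fun m => g2 S b 1 c m) ∧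
    euC (TR S a b c) = (if a = c then (1 : ℂ) else 0) • euC (fun m => g2 S b 1 c m) ∧
    etC (TL S a b c)
      = ((1 / 16 : ℂ) + (if a = b then (1 / 2 : ℂ) else 0)) • etC (fun m => g2 S b 1 c m) ∧
    etC (TR S a b c)
      = ((1 / 16 : ℂ) + (if a = c then (1 / 2 : ℂ) else 0)) • etC (fun m => g2 S b 1 c m) := by
  have e916 : (1 / 16 : ℂ) + 1 / 2 = 9 / 16 := by norm_num
  by_cases hab : a = b
  · subst hab
    have R := relB_holds S a c hbc
    have h6 := rel6_holds S hbc
    rw [TL_left S hbc, TR_left S hbc]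
    simp only [hbc, if_true, if_false, add_zero, e916]
    exact ⟨R.ul h6, R.ur h6, R.tl h6, R.tr h6⟩
  · by_cases hac : a = c
    · subst hac
      have R := relB_holds S a b hbc.symm
      have h6 := rel6_holds' S hbc
      rw [TL_right S hbc, TR_right S hbc]
      have eg : (fun m => g2 S b 1 a m) = fun m => g2 S a m b 1 := by
        funext m
        exact g2_swap S _ _ _ _
      rw [eg]
      simp only [hab, if_true, if_false, add_zero, e916]
      exact ⟨R.ul2 h6, R.ur2 h6, R.tl2 h6, R.tr2 h6⟩
    · have R := relA_holds S a b c hab hac hbc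
      have h6 := rel6_holds S hbc
      rw [TL_none S hab hac, TR_none S hab hac]
      simp only [hab, hac, if_false, add_zero]
      exact ⟨R.u h6, R.u h6, R.t h6, R.t h6⟩

/-- The quotient map from `𝓗⁺`. -/
def qW : W →ₗ[ℂ] V ⧸ OV S := (OV S).mkQ ∘ₗ S.ι

theorem qW_eq_zero (w : W) : qW S w = 0 ↔ w ∈ S.B.Osub := by
  rw [← mem_OV]
  exact Submodule.Quotient.mk_eq_zero _

theorem omega_wt_two {w : W} {a : Fin ℓ} (h : S.ι w = omegaV S.A S.hgen a) : w ∈ S.B.wt 2 := by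
  rw [S.fixedSub.map_wt, h]
  exact Submodule.smul_mem _ _ (wt_wd2 S.heis a a 1 1)

theorem qW_omega {w v : W} {a b c : Fin ℓ} {m : ℕ} (h : S.ι w = omegaV S.A S.hgen a)
    (hv : S.ι v = wd2 S.A S.hgen b 1 c m) (n : ℤ) :
    qW S (S.B.Y w n v) = (1 / 2 : ℂ) •
      (OV S).mkQ (S.A.Y (SV S.A S.hgen a a 1 1) n (wd2 S.A S.hgen b 1 c m)) := by
  unfold qW
  rw [LinearMap.comp_apply, S.fixedSub.map_Y, h, hv, omegaV]
  simp

theorem qW_left {w v : W} {a b c : Fin ℓ} {m : ℕ} (h : S.ι w = omegaV S.A S.hgen a)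
    (hv : S.ι v = wd2 S.A S.hgen b 1 c m) (hm : 1 ≤ m) :
    qW S (S.B.mulAux 2 w v) = TL S a b c m := by
  rw [S.B.mulAux_two]
  simp only [map_add, map_smul]
  rw [qW_omega S h hv, qW_omega S h hv, qW_omega S h hv, q_mode2 S _ _ _ _ _ _ le_rfl hm,
    q_mode1 S _ _ _ _ _ _ le_rfl hm, q_mode0 S _ _ _ _ _ _ le_rfl hm, TL]
  module

theorem qW_right {w v : W} {a b c : Fin ℓ} {m : ℕ} (h : S.ι w = omegaV S.A S.hgen a)
    (hv : S.ι v = wd2 S.A S.hgen b 1 c m) (hm : 1 ≤ m) :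
    qW S (S.B.star v w) = TR S a b c m := by
  have hvw : v ∈ S.B.wt (1 + m) := by
    rw [S.fixedSub.map_wt, hv]
    exact_mod_cast wt_wd2 S.heis b c 1 m
  have h1 := (qW_eq_zero S _).2 (S.B.star_right hvw (omega_wt_two S h))
  rw [map_sub, sub_eq_zero, map_add] at h1
  rw [h1, qW_omega S h hv, qW_omega S h hv, q_mode2 S _ _ _ _ _ _ le_rfl hm,
    q_mode1 S _ _ _ _ _ _ le_rfl hm, TR]
  module

end final

end

/-- Lemma 5.2.2. For any `a` and distinct `b,c`, in `A(𝓗⁺)`: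
`ω_a * E^u_{bc} = δ_{ab} E^u_{bc}`, `E^u_{bc} * ω_a = δ_{ac} E^u_{bc}`,
`ω_a * E^t_{bc} = (1/16 + δ_{ab}/2) E^t_{bc}`, and
`E^t_{bc} * ω_a = (1/16 + δ_{ac}/2) E^t_{bc}`. -/
theorem statement15 (ℓ : ℕ) {V W : Type} [AddCommGroup V] [Module ℂ V]
    [AddCommGroup W] [Module ℂ W] (S : HeisenbergPlusSetting ℓ V W)
    (s : Fin ℓ → Fin ℓ → ℤ → ℤ → W)
    (hs : ∀ a b m n, S.ι (s a b m n) = SV S.A S.hgen a b m n)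
    (ow : Fin ℓ → W) (how : ∀ a, S.ι (ow a) = omegaV S.A S.hgen a)
    (a b c : Fin ℓ) (hbc : b ≠ c) :
    (S.B.star (ow a) (EuW s b c)
      - (if a = b then (1 : ℂ) else 0) • EuW s b c ∈ S.B.Osub) ∧
    (S.B.star (EuW s b c) (ow a)
      - (if a = c then (1 : ℂ) else 0) • EuW s b c ∈ S.B.Osub) ∧
    (S.B.star (ow a) (EtW s b c)
      - ((1 / 16 : ℂ) + (if a = b then (1 / 2 : ℂ) else 0)) • EtW s b c ∈ S.B.Osub) ∧
    (S.B.star (EtW s b c) (ow a)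
      - ((1 / 16 : ℂ) + (if a = c then (1 / 2 : ℂ) else 0)) • EtW s b c ∈ S.B.Osub) := by
  have hv : ∀ m : ℕ, S.ι (s b c 1 m) = wd2 S.A S.hgen b 1 c m := by
    intro m
    rw [hs, ← SV_eq_wd2, Nat.cast_one]
  have h2 := hv 2
  have h3 := hv 3
  have h4 := hv 4
  have h5 := hv 5
  simp only [Nat.cast_ofNat] at h2 h3 h4 h5
  have q : ∀ (m : ℕ) (v : W), S.ι v = wd2 S.A S.hgen b 1 c m → qW S v = g2 S b 1 c m := by
    intro m v h
    unfold qW g2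
    rw [LinearMap.comp_apply, h]
  have lin : ∀ v w : W, S.B.star (ow a) (v + w) = S.B.star (ow a) v + S.B.star (ow a) w := by
    intro v w
    simp only [S.B.star_hom (omega_wt_two S (how a)), S.B.mulAux_two, map_add, smul_add]
    abel
  have lin2 : ∀ (z : ℂ) (v : W), S.B.star (ow a) (z • v) = z • S.B.star (ow a) v := by
    intro z v
    simp only [S.B.star_hom (omega_wt_two S (how a)), S.B.mulAux_two, map_smul]
    module
  have L : ∀ (m : ℕ) (v : W), S.ι v = wd2 S.A S.hgen b 1 c m → 1 ≤ m →
      qW S (S.B.star (ow a) v) = TL S a b c m := by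
    intro m v h hm
    rw [S.B.star_hom (omega_wt_two S (how a))]
    exact qW_left S (how a) h hm
  have R : ∀ (m : ℕ) (v : W), S.ι v = wd2 S.A S.hgen b 1 c m → 1 ≤ m →
      qW S (S.B.star v (ow a)) = TR S a b c m := fun m v h hm => qW_right S (how a) h hm
  obtain ⟨i1, i2, i3, i4⟩ := quot_identities S a b c hbc
  have qu : qW S (EuW s b c) = euC (fun m => g2 S b 1 c m) := by
    simp only [EuW, euC, map_add, map_smul, q 2 _ h2, q 3 _ h3, q 4 _ h4, q 5 _ h5]
  have qt : qW S (EtW s b c) = etC (fun m => g2 S b 1 c m) := by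
    simp only [EtW, etC, map_add, map_smul, q 2 _ h2, q 3 _ h3, q 4 _ h4, q 5 _ h5]
  refine ⟨?_, ?_, ?_, ?_⟩
  · rw [← qW_eq_zero, map_sub, map_smul, qu, sub_eq_zero, ← i1]
    simp only [EuW, euC, lin, lin2, map_add, map_smul]
    rw [L 2 _ h2, L 3 _ h3, L 4 _ h4, L 5 _ h5] <;> norm_num
  · rw [← qW_eq_zero, map_sub, map_smul, qu, sub_eq_zero, ← i2]
    simp only [EuW, euC, S.B.star_add, S.B.star_smul, map_add, map_smul]
    rw [R 2 _ h2, R 3 _ h3, R 4 _ h4, R 5 _ h5] <;> norm_num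
  · rw [← qW_eq_zero, map_sub, map_smul, qt, sub_eq_zero, ← i3]
    simp only [EtW, etC, lin, lin2, map_add, map_smul]
    rw [L 2 _ h2, L 3 _ h3, L 4 _ h4, L 5 _ h5] <;> norm_num
  · rw [← qW_eq_zero, map_sub, map_smul, qt, sub_eq_zero, ← i4]
    simp only [EtW, etC, S.B.star_add, S.B.star_smul, map_add, map_smul]
    rw [R 2 _ h2, R 3 _ h3, R 4 _ h4, R 5 _ h5] <;> norm_num
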